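/- arXiv:1605.05750 — 2 statements merged into one kernel-verified Lean document; each statement's English description precedes it below -/
import Mathlib

section
/- Assume a ground state of 𝓔ᵃ is strongly stable with constant c_a > 0, let ‖f‖_{𝒰*} be sufficiently small and L sufficiently large so that the Cauchy–Born solution u^cb, the infinite corrector solution q_∞ with F₀ = ∇u^cb(0) and decay rate μ_q ∈ [0,1), and the finite corrector solution q_L all exist. Then there is a constant C independent of f and L with ‖δ𝓔ᵃ(Π_a u^cb + q_L) − f‖_{𝒰*} ≤ C(μ_q^L + |∇²u^cb(0)| + ‖∇²u^cb‖²_{L⁴} + ‖∇³u^cb‖_{L²} + ‖∇f‖_{L²}), where ‖δ𝓔ᵃ(u) − f‖_{𝒰*} := sup{|⟨δ𝓔ᵃ(u), v⟩ − Σ f_ℓ v_ℓ| : v ∈ 𝒰, ‖v'‖_{ℓ²} = 1}. -/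
open scoped BigOperators ENNReal
open Filter MeasureTheory

noncomputable section

/-- discrete strain: `u'_ℓ = u_{ℓ+1} - u_ℓ` -/
def du (u : ℕ → ℝ) (ℓ : ℕ) : ℝ := u (ℓ + 1) - u ℓ

/-- second difference of strains: `u''_ℓ = u'_{ℓ+1} - u'_ℓ` -/
def ddu (u : ℕ → ℝ) (ℓ : ℕ) : ℝ := du u (ℓ + 1) - du u ℓ

/-- the displacement space 𝒰 -/
def memU (u : ℕ → ℝ) : Prop := u 0 = 0 ∧ Summable (fun ℓ => (du u ℓ) ^ 2)

/-- ℓ² norm of a sequence -/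
def l2 (e : ℕ → ℝ) : ℝ := Real.sqrt (∑' ℓ, (e ℓ) ^ 2)

/-- compactly supported lattice function -/
def FinSupp (u : ℕ → ℝ) : Prop := ∃ N : ℕ, ∀ ℓ : ℕ, N ≤ ℓ → u ℓ = 0

/-- membership in the dual space 𝒰* -/
def memUstar (f : ℕ → ℝ) : Prop :=
  ∃ M : ℝ, ∀ u : ℕ → ℝ, u 0 = 0 → FinSupp u → |∑' ℓ, f ℓ * u ℓ| ≤ M * l2 (du u)

/-- the dual norm ‖f‖_{𝒰*} -/
def dualNorm (f : ℕ → ℝ) : ℝ :=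
  sInf {M : ℝ | 0 ≤ M ∧ ∀ u : ℕ → ℝ, u 0 = 0 → FinSupp u →
    |∑' ℓ, f ℓ * u ℓ| ≤ M * l2 (du u)}

/-- `g_ℓ = Σ_{k=ℓ+1}^∞ f_k`, as a limit of partial sums -/
def gOf (f : ℕ → ℝ) (ℓ : ℕ) : ℝ :=
  limUnder atTop (fun K : ℕ => ∑ k ∈ Finset.Ico (ℓ + 1) K, f k)

/-- duality pairing `⟨f, v⟩` for `v ∈ 𝒰`, extended by continuity (summation by parts) -/
def pairF (f : ℕ → ℝ) (v : ℕ → ℝ) : ℝ := ∑' ℓ, gOf f ℓ * du v ℓ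

/-- partial derivatives of the bulk site potential -/
def d1V (V : ℝ → ℝ → ℝ) (r s : ℝ) : ℝ := deriv (fun t => V t s) r
def d2V (V : ℝ → ℝ → ℝ) (r s : ℝ) : ℝ := deriv (fun t => V r t) s
def d11V (V : ℝ → ℝ → ℝ) (r s : ℝ) : ℝ := deriv (fun t => d1V V t s) r
def d12V (V : ℝ → ℝ → ℝ) (r s : ℝ) : ℝ := deriv (fun t => d1V V r t) s
def d22V (V : ℝ → ℝ → ℝ) (r s : ℝ) : ℝ := deriv (fun t => d2V V r t) s

/-- Cauchy–Born energy density `W(F) = V(F,F)` and its derivatives -/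
def Wcb (V : ℝ → ℝ → ℝ) (F : ℝ) : ℝ := V F F
def dW (V : ℝ → ℝ → ℝ) (F : ℝ) : ℝ := deriv (Wcb V) F
def d2W (V : ℝ → ℝ → ℝ) (F : ℝ) : ℝ := deriv (dW V) F

/-- standing assumptions (i)–(vi) on the site energies -/
structure SiteAssumptions (V : ℝ → ℝ → ℝ) (Vs : ℝ → ℝ) : Prop where
  smooth_V : ContDiff ℝ 3 (Function.uncurry V)
  smooth_Vs : ContDiff ℝ 3 Vs
  bdd_V : ∀ i : ℕ, i ≤ 3 → ∃ B : ℝ, ∀ p : ℝ × ℝ,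
    ‖iteratedFDeriv ℝ i (Function.uncurry V) p‖ ≤ B
  bdd_Vs : ∀ i : ℕ, i ≤ 3 → ∃ B : ℝ, ∀ x : ℝ, ‖iteratedFDeriv ℝ i Vs x‖ ≤ B
  V_zero : V 0 0 = 0
  posdef : ∀ p : ℝ × ℝ, p ≠ 0 →
    0 < d11V V 0 0 * p.1 ^ 2 + 2 * d12V V 0 0 * p.1 * p.2 + d22V V 0 0 * p.2 ^ 2
  pos_away : ∀ ε : ℝ, 0 < ε → ∃ δ : ℝ, 0 < δ ∧
    ∀ r s : ℝ, ε < Real.sqrt (r ^ 2 + s ^ 2) → δ ≤ V r s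
  surf_limit : ∀ s : ℝ, Tendsto (fun r => V r s) atTop (nhds (Vs s))

/-- atomistic energy, with values in `[0,∞]` (the site energies are nonnegative
under the standing assumptions) -/
def EaE (V : ℝ → ℝ → ℝ) (Vs : ℝ → ℝ) (u : ℕ → ℝ) : ℝ≥0∞ :=
  ENNReal.ofReal (Vs (du u 0)) +
    ∑' ℓ : ℕ, ENNReal.ofReal (V (du u ℓ) (du u (ℓ + 1)))

/-- ground state: global minimizer of the atomistic energy over 𝒰 -/
def GroundState (V : ℝ → ℝ → ℝ) (Vs : ℝ → ℝ) (u : ℕ → ℝ) : Prop :=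
  memU u ∧ ∀ w : ℕ → ℝ, memU w → EaE V Vs u ≤ EaE V Vs w

/-- first variation of 𝓔ᵃ, as a function of the strain sequence `e` -/
def fvA (V : ℝ → ℝ → ℝ) (Vs : ℝ → ℝ) (e : ℕ → ℝ) (v : ℕ → ℝ) : ℝ :=
  du v 0 * (deriv Vs (e 0) + d1V V (e 0) (e 1)) +
    ∑' ℓ : ℕ, du v (ℓ + 1) *
      (d2V V (e ℓ) (e (ℓ + 1)) + d1V V (e (ℓ + 1)) (e (ℓ + 2)))

/-- second variation (of 𝓔ᵃ, and of 𝓔^Γ) as a function of the strain sequence `e` -/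
def svA (V : ℝ → ℝ → ℝ) (Vs : ℝ → ℝ) (e : ℕ → ℝ) (v : ℕ → ℝ) : ℝ :=
  deriv (deriv Vs) (e 0) * (du v 0) ^ 2 +
    ∑' ℓ : ℕ, (d11V V (e ℓ) (e (ℓ + 1)) * (du v ℓ) ^ 2
      + 2 * d12V V (e ℓ) (e (ℓ + 1)) * du v ℓ * du v (ℓ + 1)
      + d22V V (e ℓ) (e (ℓ + 1)) * (du v (ℓ + 1)) ^ 2)

/-- a strongly stable ground state with stability constant `c` -/
def StronglyStableGS (V : ℝ → ℝ → ℝ) (Vs : ℝ → ℝ) (u : ℕ → ℝ) (c : ℝ) : Prop :=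
  GroundState V Vs u ∧ 0 < c ∧
    ∀ v : ℕ → ℝ, memU v → c * ∑' ℓ, (du v ℓ) ^ 2 ≤ svA V Vs (du u) v

/-- critical point of 𝓔ᵃ: the pointwise Euler–Lagrange equations -/
def CriticalA (V : ℝ → ℝ → ℝ) (Vs : ℝ → ℝ) (u : ℕ → ℝ) : Prop :=
  deriv Vs (du u 0) + d1V V (du u 0) (du u 1) = 0 ∧
  ∀ ℓ : ℕ, d2V V (du u ℓ) (du u (ℓ + 1)) + d1V V (du u (ℓ + 1)) (du u (ℓ + 2)) = 0

/-- first variation of the corrector energy 𝓔^Γ(·;F₀) -/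
def fvG (V : ℝ → ℝ → ℝ) (Vs : ℝ → ℝ) (F0 : ℝ) (q v : ℕ → ℝ) : ℝ :=
  du v 0 * (deriv Vs (F0 + du q 0) + d1V V (F0 + du q 0) (F0 + du q 1) - dW V F0) +
    ∑' ℓ : ℕ, du v (ℓ + 1) *
      (d2V V (F0 + du q ℓ) (F0 + du q (ℓ + 1))
        + d1V V (F0 + du q (ℓ + 1)) (F0 + du q (ℓ + 2)) - dW V F0)

/-- critical point of the corrector energy: pointwise Euler–Lagrange equations -/
def CriticalG (V : ℝ → ℝ → ℝ) (Vs : ℝ → ℝ) (F0 : ℝ) (q : ℕ → ℝ) : Prop :=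
  deriv Vs (F0 + du q 0) + d1V V (F0 + du q 0) (F0 + du q 1) - dW V F0 = 0 ∧
  ∀ ℓ : ℕ, d2V V (F0 + du q ℓ) (F0 + du q (ℓ + 1))
      + d1V V (F0 + du q (ℓ + 1)) (F0 + du q (ℓ + 2)) - dW V F0 = 0

/-- second variation of the corrector energy at `q` -/
def svG (V : ℝ → ℝ → ℝ) (Vs : ℝ → ℝ) (F0 : ℝ) (q v : ℕ → ℝ) : ℝ :=
  svA V Vs (fun ℓ => F0 + du q ℓ) v

/-- membership in 𝒬_L -/
def memQL (L : ℕ) (q : ℕ → ℝ) : Prop := memU q ∧ ∀ ℓ : ℕ, L ≤ ℓ → du q ℓ = 0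

/-- continuous piecewise affine interpolant of a lattice function -/
def fAff (f : ℕ → ℝ) (x : ℝ) : ℝ :=
  f ⌊x⌋₊ + (x - (⌊x⌋₊ : ℝ)) * (f (⌊x⌋₊ + 1) - f ⌊x⌋₊)

/-- `g̃(x) = ∫_x^∞ f(s) ds`, improper integral of the interpolant -/
def gTilde (f : ℕ → ℝ) (x : ℝ) : ℝ :=
  limUnder atTop (fun K : ℕ => ∫ t in x..(K : ℝ), fAff f t)

/-- the Cauchy–Born continuum energy of a strain field `w = ∇u`, valued in `[0,∞]` -/
def EcbE (V : ℝ → ℝ → ℝ) (w : ℝ → ℝ) : ℝ≥0∞ :=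
  ∫⁻ x in Set.Ioi (0 : ℝ), ENNReal.ofReal (Wcb V (w x))

/-- strain of the projection `Π_a u^cb`, given the gradient `w = ∇u^cb` -/
def PiA (w : ℝ → ℝ) (ℓ : ℕ) : ℝ := ∫ t in (ℓ : ℝ)..((ℓ : ℝ) + 1), w t

/-- the data of "the" strongly stable Cauchy–Born solution for the force `f`:
`w = ∇u^cb`, `w1 = ∇²u^cb`, `w2 = ∇³u^cb`, with constant `Cw` -/
def CBSolution (V : ℝ → ℝ → ℝ) (f : ℕ → ℝ) (Cw : ℝ) (w w1 w2 : ℝ → ℝ) : Prop :=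
  MemLp w 2 (volume.restrict (Set.Ioi 0)) ∧
  (∀ᵐ x ∂(volume.restrict (Set.Ioi (0 : ℝ))), dW V (w x) = gTilde f x) ∧
  (∃ ccb : ℝ, 0 < ccb ∧ ∀ vw : ℝ → ℝ, MemLp vw 2 (volume.restrict (Set.Ioi 0)) →
    ccb * ∫ x in Set.Ioi (0 : ℝ), (vw x) ^ 2 ≤
      ∫ x in Set.Ioi (0 : ℝ), d2W V (w x) * (vw x) ^ 2) ∧
  (∀ x ∈ Set.Ici (0 : ℝ), HasDerivAt w (w1 x) x) ∧
  (∀ᵐ x ∂(volume.restrict (Set.Ioi (0 : ℝ))), HasDerivAt w1 (w2 x) x) ∧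
  |w 0| ≤ Cw * dualNorm f

/-- Quantitative smoothness of the site potentials. -/
structure SiteBounds (V : ℝ → ℝ → ℝ) (Vs : ℝ → ℝ) (K : ℝ) : Prop where
  nonneg : 0 ≤ K
  dVs_lip : ∀ x y, |deriv Vs x - deriv Vs y| ≤ K * |x - y|
  d1V_lip : ∀ r s r' s', |d1V V r s - d1V V r' s'| ≤ K * (|r - r'| + |s - s'|)
  d2V_lip : ∀ r s r' s', |d2V V r s - d2V V r' s'| ≤ K * (|r - r'| + |s - s'|)
  dW_eq : ∀ x, dW V x = d1V V x x + d2V V x x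
  dW_lip : ∀ x y, |dW V x - dW V y| ≤ K * |x - y|
  d2W_lip : ∀ x y, |d2W V x - d2W V y| ≤ K * |x - y|
  d1V_mixed : ∀ r s F a b, |d1V V (r + a) (s + b) - d1V V r s - (d1V V (F + a) (F + b) - d1V V F F)|
    ≤ K * ((|a| + |b|) * (|r - F| + |s - F|))
  d2V_mixed : ∀ r s F a b, |d2V V (r + a) (s + b) - d2V V r s - (d2V V (F + a) (F + b) - d2V V F F)|
    ≤ K * ((|a| + |b|) * (|r - F| + |s - F|))
  stress : ∀ r s t, |d2V V r s + d1V V s t - dW V s|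
    ≤ K * (|r - s| ^ 2 + |t - s| ^ 2 + |r - 2 * s + t|)

lemma norm_prod_le_add (a b : ℝ) : ‖((a, b) : ℝ × ℝ)‖ ≤ |a| + |b| := by
  rw [Prod.norm_mk, Real.norm_eq_abs, Real.norm_eq_abs]
  exact max_le (by linarith [abs_nonneg b]) (by linarith [abs_nonneg a])

lemma abs_apply_le_of_norm_le {φ : ℝ × ℝ →L[ℝ] ℝ} {C : ℝ} (h : ‖φ‖ ≤ C) (x : ℝ × ℝ)
    (hx : ‖x‖ ≤ 1) : |φ x| ≤ C := by
  have h1 := φ.le_opNorm x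
  rw [Real.norm_eq_abs] at h1
  nlinarith [norm_nonneg φ, norm_nonneg x]

set_option maxSynthPendingDepth 3 in
lemma norm_sub_le_of_fderiv_bound {E F : Type*} [NormedAddCommGroup E] [NormedSpace ℝ E]
    [NormedAddCommGroup F] [NormedSpace ℝ F] {φ : E → F} (hφ : Differentiable ℝ φ) {B : ℝ}
    (hB : ∀ x, ‖fderiv ℝ φ x‖ ≤ B) (x y : E) : ‖φ x - φ y‖ ≤ B * ‖x - y‖ :=
  convex_univ.norm_image_sub_le_of_norm_fderiv_le (fun z _ => hφ z) (fun z _ => hB z)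
    (Set.mem_univ y) (Set.mem_univ x)

set_option maxSynthPendingDepth 3 in
/-- First-order Taylor estimate for a map with Lipschitz derivative. -/
lemma norm_taylor_le {E F : Type*} [NormedAddCommGroup E] [NormedSpace ℝ E]
    [NormedAddCommGroup F] [NormedSpace ℝ F] {φ : E → F} (hφ : Differentiable ℝ φ) {B : ℝ}
    (hB0 : 0 ≤ B)
    (hB : ∀ x y, ‖fderiv ℝ φ x - fderiv ℝ φ y‖ ≤ B * ‖x - y‖) (x y : E) :
    ‖φ y - φ x - fderiv ℝ φ x (y - x)‖ ≤ B * ‖y - x‖ * ‖y - x‖ := by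
  refine (convex_closedBall x ‖y - x‖).norm_image_sub_le_of_norm_hasFDerivWithin_le'
    (f' := fderiv ℝ φ) (fun z _ => (hφ z).hasFDerivAt.hasFDerivWithinAt) (fun z hz => ?_)
    (Metric.mem_closedBall_self (norm_nonneg _)) ?_
  · refine (hB z x).trans ?_
    rw [mem_closedBall_iff_norm] at hz
    gcongr
  · rw [mem_closedBall_iff_norm]

set_option maxSynthPendingDepth 3 in
lemma SiteAssumptions.exists_siteBounds {V : ℝ → ℝ → ℝ} {Vs : ℝ → ℝ}
    (h : SiteAssumptions V Vs) : ∃ K, SiteBounds V Vs K := by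
  set U := Function.uncurry V with hU
  set φ := fderiv ℝ U with hφdef
  set ψ := fderiv ℝ φ with hψdef
  have hUc : ContDiff ℝ 3 U := h.smooth_V
  have hφc : ContDiff ℝ 2 φ := hUc.fderiv_right (by norm_num)
  have hψc : ContDiff ℝ 1 ψ := hφc.fderiv_right (by norm_num)
  have hUd : Differentiable ℝ U := hUc.differentiable (by norm_num)
  have hφd : Differentiable ℝ φ := hφc.differentiable (by norm_num)
  have hψd : Differentiable ℝ ψ := hψc.differentiable (by norm_num)
  obtain ⟨B2, hB2⟩ := h.bdd_V 2 (by norm_num)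
  obtain ⟨B3, hB3⟩ := h.bdd_V 3 (by norm_num)
  obtain ⟨S, hS⟩ := h.bdd_Vs 2 (by norm_num)
  have hψB : ∀ x, ‖ψ x‖ ≤ B2 := fun x => by
    have := hB2 x
    rwa [← norm_iteratedFDeriv_fderiv, ← norm_iteratedFDeriv_fderiv,
      norm_iteratedFDeriv_zero] at this
  have hψ'B : ∀ x, ‖fderiv ℝ ψ x‖ ≤ B3 := fun x => by
    have := hB3 x
    rwa [← norm_iteratedFDeriv_fderiv, ← norm_iteratedFDeriv_fderiv,
      ← norm_iteratedFDeriv_fderiv, norm_iteratedFDeriv_zero] at this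
  have hB20 : 0 ≤ B2 := (norm_nonneg _).trans (hψB 0)
  have hB30 : 0 ≤ B3 := (norm_nonneg _).trans (hψ'B 0)
  have hVs' : ∀ x, ‖deriv (deriv Vs) x‖ ≤ S := fun x => by
    have := hS x
    rw [norm_iteratedFDeriv_eq_norm_iteratedDeriv, iteratedDeriv_succ, iteratedDeriv_one] at this
    exact this
  have hS0 : 0 ≤ S := (norm_nonneg _).trans (hVs' 0)
  have hφlip := norm_sub_le_of_fderiv_bound hφd hψB
  have hψlip := norm_sub_le_of_fderiv_bound hψd hψ'B
  have htay := norm_taylor_le hφd hB30 hψlip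
  have e1 : ‖((1, 0) : ℝ × ℝ)‖ ≤ 1 := by simp
  have e2 : ‖((0, 1) : ℝ × ℝ)‖ ≤ 1 := by simp
  have e3 : ‖((1, 1) : ℝ × ℝ)‖ ≤ 1 := by simp
  have hcomp : ∀ (γ : ℝ → ℝ × ℝ) (γ' : ℝ × ℝ) (t : ℝ), HasDerivAt γ γ' t →
      deriv (fun t => U (γ t)) t = φ (γ t) γ' := fun γ γ' t hγ =>
    ((hUd (γ t)).hasFDerivAt.comp_hasDerivAt t hγ).deriv
  have hdiag : ∀ x : ℝ, HasDerivAt (fun t : ℝ => (t, t)) ((1, 1) : ℝ × ℝ) x := fun x =>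
    (hasDerivAt_id x).prodMk (hasDerivAt_id x)
  have hd1 : ∀ r s, d1V V r s = φ (r, s) (1, 0) := fun r s =>
    hcomp (fun t => (t, s)) (1, 0) r ((hasDerivAt_id r).prodMk (hasDerivAt_const r s))
  have hd2 : ∀ r s, d2V V r s = φ (r, s) (0, 1) := fun r s =>
    hcomp (fun t => (r, t)) (0, 1) s ((hasDerivAt_const s r).prodMk (hasDerivAt_id s))
  have hdW : ∀ x, dW V x = φ (x, x) (1, 1) := fun x =>
    hcomp (fun t => (t, t)) (1, 1) x (hdiag x)
  have hd2W : ∀ x, d2W V x = ψ (x, x) (1, 1) (1, 1) := fun x => by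
    have h1 : dW V = fun x => φ (x, x) (1, 1) := funext hdW
    have h2 : HasDerivAt (fun t : ℝ => φ (t, t)) (ψ (x, x) (1, 1)) x :=
      (hφd (x, x)).hasFDerivAt.comp_hasDerivAt (f := fun t : ℝ => (t, t)) x (hdiag x)
    have h3 := h2.clm_apply (hasDerivAt_const x ((1, 1) : ℝ × ℝ))
    rw [d2W, h1]
    simpa using h3.deriv
  have hsplit : ∀ x, dW V x = d1V V x x + d2V V x x := fun x => by
    rw [hdW, hd1, hd2, ← map_add]; simp
  have hmix : ∀ r s F a b : ℝ, ‖φ (r + a, s + b) - φ (r, s) - (φ (F + a, F + b) - φ (F, F))‖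
      ≤ B3 * ((|a| + |b|) * (|r - F| + |s - F|)) := fun r s F a b => by
    have hd : ∀ z, HasFDerivAt (fun z => φ (z + (a, b)) - φ z) (ψ (z + (a, b)) - ψ z) z :=
      fun z => by
        have h1 : HasFDerivAt (fun z : ℝ × ℝ => z + (a, b)) (ContinuousLinearMap.id ℝ (ℝ × ℝ)) z :=
          (hasFDerivAt_id z).add_const (a, b)
        have h2 := (hφd (z + (a, b))).hasFDerivAt.comp z h1
        rw [ContinuousLinearMap.comp_id] at h2
        exact h2.sub (hφd z).hasFDerivAt
    have hb : ∀ z, ‖fderiv ℝ (fun z => φ (z + (a, b)) - φ z) z‖ ≤ B3 * (|a| + |b|) := fun z => by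
      rw [(hd z).fderiv]
      refine (hψlip _ _).trans ?_
      gcongr
      rw [add_sub_cancel_left]
      exact norm_prod_le_add a b
    have := norm_sub_le_of_fderiv_bound (fun z => (hd z).differentiableAt) hb (r, s) (F, F)
    simp only [Prod.mk_add_mk] at this
    refine this.trans ?_
    rw [mul_assoc]
    gcongr
    exact norm_prod_le_add _ _
  have hlip : ∀ r s r' s' : ℝ, ‖φ (r, s) - φ (r', s')‖ ≤ B2 * (|r - r'| + |s - s'|) :=
    fun r s r' s' => (hφlip _ _).trans (by gcongr; exact norm_prod_le_add _ _)
  refine ⟨S + 2 * B2 + 2 * B3, by positivity, ?_, ?_, ?_, hsplit, ?_, ?_, ?_, ?_, ?_⟩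
  · intro x y
    have hd : Differentiable ℝ (deriv Vs) := by
      have : ContDiff ℝ 2 (deriv Vs) := h.smooth_Vs.deriv'
      exact this.differentiable (by norm_num)
    have := convex_univ.norm_image_sub_le_of_norm_deriv_le (f := deriv Vs) (fun z _ => hd z)
      (fun z _ => hVs' z) (Set.mem_univ y) (Set.mem_univ x)
    refine this.trans ?_
    rw [Real.norm_eq_abs]
    gcongr
    linarith
  · intro r s r' s'
    rw [hd1, hd1, ← sub_apply]
    refine (abs_apply_le_of_norm_le (hlip r s r' s') _ e1).trans ?_
    gcongr
    linarith
  · intro r s r' s'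
    rw [hd2, hd2, ← sub_apply]
    refine (abs_apply_le_of_norm_le (hlip r s r' s') _ e2).trans ?_
    gcongr
    linarith
  · intro x y
    rw [hdW, hdW, ← sub_apply]
    refine (abs_apply_le_of_norm_le (hlip x x y y) _ e3).trans ?_
    nlinarith [abs_nonneg (x - y), mul_nonneg (add_nonneg hS0 hB30) (abs_nonneg (x - y)),
      mul_nonneg hB30 (abs_nonneg (x - y))]
  · intro x y
    rw [hd2W, hd2W, ← sub_apply, ← sub_apply]
    have h1 : ‖ψ (x, x) - ψ (y, y)‖ ≤ B3 * (|x - y| + |x - y|) :=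
      (hψlip _ _).trans (by gcongr; exact norm_prod_le_add _ _)
    have h2 : ‖(ψ (x, x) - ψ (y, y)) (1, 1)‖ ≤ B3 * (|x - y| + |x - y|) := by
      refine ((ψ (x, x) - ψ (y, y)).le_opNorm _).trans ?_
      nlinarith [norm_nonneg (ψ (x, x) - ψ (y, y))]
    refine (abs_apply_le_of_norm_le h2 _ e3).trans ?_
    nlinarith [mul_nonneg hS0 (abs_nonneg (x - y)), mul_nonneg hB20 (abs_nonneg (x - y))]
  · intro r s F a b
    simp only [hd1, ← sub_apply]
    refine (abs_apply_le_of_norm_le (hmix r s F a b) _ e1).trans ?_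
    gcongr
    linarith
  · intro r s F a b
    simp only [hd2, ← sub_apply]
    refine (abs_apply_le_of_norm_le (hmix r s F a b) _ e2).trans ?_
    gcongr
    linarith
  · intro r s t
    have t1 := htay (s, s) (r, s)
    have t2 := htay (s, s) (s, t)
    have n1 : ‖((r, s) : ℝ × ℝ) - (s, s)‖ = |r - s| := by simp
    have n2 : ‖((s, t) : ℝ × ℝ) - (s, s)‖ = |t - s| := by simp
    rw [← hψdef, n1] at t1
    rw [← hψdef, n2] at t2
    have a1 := abs_apply_le_of_norm_le t1 _ e2
    have a2 := abs_apply_le_of_norm_le t2 _ e1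
    have hsymm : ψ (s, s) (0, 1) (1, 0) = ψ (s, s) (1, 0) (0, 1) :=
      (hUc.contDiffAt.isSymmSndFDerivAt (by simp; norm_num)).eq _ _
    have m1 : ψ (s, s) ((r, s) - (s, s)) (0, 1) = (r - s) * ψ (s, s) (1, 0) (0, 1) := by
      have : ((r, s) : ℝ × ℝ) - (s, s) = (r - s) • (1, 0) := by simp
      rw [this, map_smul]; simp
    have m2 : ψ (s, s) ((s, t) - (s, s)) (1, 0) = (t - s) * ψ (s, s) (1, 0) (0, 1) := by
      have : ((s, t) : ℝ × ℝ) - (s, s) = (t - s) • (0, 1) := by simp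
      rw [this, map_smul, ← hsymm]; simp
    simp only [sub_apply, m1] at a1
    simp only [sub_apply, m2] at a2
    have hκ : |ψ (s, s) (1, 0) (0, 1)| ≤ B2 := by
      refine abs_apply_le_of_norm_le ?_ _ e2
      refine ((ψ (s, s)).le_opNorm _).trans ?_
      nlinarith [norm_nonneg (ψ (s, s)), hψB (s, s)]
    rw [hsplit, hd1, hd2, hd1, hd2]
    have hκ' : |(r - 2 * s + t) * ψ (s, s) (1, 0) (0, 1)| ≤ B2 * |r - 2 * s + t| := by
      rw [abs_mul, mul_comm]
      gcongr
    have key : |φ (r, s) (0, 1) + φ (s, t) (1, 0) - (φ (s, s) (1, 0) + φ (s, s) (0, 1))| ≤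
        B3 * |r - s| * |r - s| + B3 * |t - s| * |t - s| + B2 * |r - 2 * s + t| := by
      refine le_trans ?_ (add_le_add (add_le_add a1 a2) hκ')
      refine le_trans (le_of_eq ?_) (abs_add_three _ _ _)
      congr 1
      ring
    refine key.trans ?_
    generalize |r - s| = x at *
    generalize |t - s| = y at *
    have hz := abs_nonneg (r - 2 * s + t)
    generalize |r - 2 * s + t| = z at *
    have := mul_nonneg hS0 (sq_nonneg x)
    have := mul_nonneg hS0 (sq_nonneg y)
    have := mul_nonneg hB20 (sq_nonneg x)
    have := mul_nonneg hB20 (sq_nonneg y)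
    have := mul_nonneg hB30 (sq_nonneg x)
    have := mul_nonneg hB30 (sq_nonneg y)
    have := mul_nonneg hS0 hz
    have := mul_nonneg hB20 hz
    have := mul_nonneg hB30 hz
    linarith

/-- The `ℓ²` norm of `a` is finite and at most `A`. -/
def L2Bound (a : ℕ → ℝ) (A : ℝ) : Prop :=
  0 ≤ A ∧ ∀ N, ∑ n ∈ Finset.range N, a n ^ 2 ≤ A ^ 2

namespace L2Bound

variable {a b : ℕ → ℝ} {A B c : ℝ}

lemma summable (h : L2Bound a A) : Summable fun n => a n ^ 2 :=
  summable_of_sum_range_le (fun n => sq_nonneg (a n)) h.2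

lemma of_summable (h : Summable fun n => a n ^ 2) : L2Bound a (l2 a) := by
  refine ⟨Real.sqrt_nonneg _, fun N => ?_⟩
  rw [l2, Real.sq_sqrt (tsum_nonneg fun n => sq_nonneg (a n))]
  exact h.sum_le_tsum _ fun n _ => sq_nonneg (a n)

lemma of_le (h : L2Bound a A) (hAB : A ≤ B) : L2Bound a B :=
  ⟨h.1.trans hAB, fun N => (h.2 N).trans (pow_le_pow_left₀ h.1 hAB 2)⟩

lemma mono (h : L2Bound b A) (hab : ∀ n, |a n| ≤ |b n|) : L2Bound a A :=
  ⟨h.1, fun N => (Finset.sum_le_sum fun n _ => sq_le_sq.2 (hab n)).trans (h.2 N)⟩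

lemma mono' (h : L2Bound b A) (hab : ∀ n, |a n| ≤ b n) : L2Bound a A :=
  h.mono fun n => (hab n).trans (le_abs_self _)

lemma abs (h : L2Bound a A) : L2Bound (fun n => |a n|) A :=
  h.mono fun n => (abs_abs (a n)).le

lemma const_mul (h : L2Bound a A) (hc : 0 ≤ c) : L2Bound (fun n => c * a n) (c * A) := by
  refine ⟨mul_nonneg hc h.1, fun N => ?_⟩
  simp only [mul_pow, ← Finset.mul_sum]
  exact mul_le_mul_of_nonneg_left (h.2 N) (sq_nonneg c)

lemma add (ha : L2Bound a A) (hb : L2Bound b B) : L2Bound (fun n => a n + b n) (A + B) := by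
  refine ⟨add_nonneg ha.1 hb.1, fun N => ?_⟩
  have hcs := Finset.sum_mul_sq_le_sq_mul_sq (Finset.range N) a b
  have h1 := ha.2 N
  have h2 := hb.2 N
  have h3 : ∑ n ∈ Finset.range N, a n * b n ≤ A * B := by
    refine abs_le_of_sq_le_sq' ?_ (mul_nonneg ha.1 hb.1) |>.2
    rw [mul_pow]
    refine hcs.trans (mul_le_mul h1 h2 (Finset.sum_nonneg fun n _ => sq_nonneg _) (sq_nonneg A))
  have h4 : ∑ n ∈ Finset.range N, (a n + b n) ^ 2 = ∑ n ∈ Finset.range N, a n ^ 2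
      + 2 * ∑ n ∈ Finset.range N, a n * b n + ∑ n ∈ Finset.range N, b n ^ 2 := by
    rw [Finset.mul_sum, ← Finset.sum_add_distrib, ← Finset.sum_add_distrib]
    exact Finset.sum_congr rfl fun n _ => by ring
  rw [h4]
  nlinarith

lemma shift (h : L2Bound a A) (k : ℕ) : L2Bound (fun n => a (n + k)) A := by
  refine ⟨h.1, fun N => le_trans ?_ (h.2 (N + k))⟩
  rw [add_comm N k, Finset.sum_range_add]
  simp only [add_comm k]
  exact le_add_of_nonneg_left (Finset.sum_nonneg fun n _ => sq_nonneg _)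

lemma abs_le (h : L2Bound a A) (n : ℕ) : |a n| ≤ A := by
  refine abs_le_of_sq_le_sq ?_ h.1
  refine le_trans ?_ (h.2 (n + 1))
  exact Finset.single_le_sum (f := fun k => a k ^ 2) (fun k _ => sq_nonneg _)
    (Finset.self_mem_range_succ n)

lemma summable_mul (ha : L2Bound a A) (hb : L2Bound b B) : Summable fun n => a n * b n := by
  refine Summable.of_norm_bounded (ha.summable.add hb.summable) fun n => ?_
  rw [Real.norm_eq_abs, abs_mul]
  nlinarith [sq_abs (a n), sq_abs (b n), sq_nonneg (|a n| - |b n|), abs_nonneg (a n),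
    abs_nonneg (b n)]

lemma abs_tsum_mul_le (ha : L2Bound a A) (hb : L2Bound b B) : |∑' n, a n * b n| ≤ A * B := by
  have ht := (ha.summable_mul hb).hasSum.tendsto_sum_nat.abs
  refine le_of_tendsto' ht fun N => abs_le_of_sq_le_sq ?_ (mul_nonneg ha.1 hb.1)
  rw [mul_pow]
  exact (Finset.sum_mul_sq_le_sq_mul_sq _ a b).trans
    (mul_le_mul (ha.2 N) (hb.2 N) (Finset.sum_nonneg fun n _ => sq_nonneg _) (sq_nonneg A))

end L2Bound

lemma exists_l2Bound_poly_geometric {μ : ℝ} (h0 : 0 ≤ μ) (h1 : μ < 1) :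
    ∃ G, L2Bound (fun n : ℕ => μ ^ n * ((n : ℝ) + 3) ^ 2) G := by
  have hr : ‖μ ^ 2‖ < 1 := by
    rw [Real.norm_eq_abs, abs_of_nonneg (sq_nonneg μ)]
    nlinarith
  have hs := fun k : ℕ => summable_pow_mul_geometric_of_norm_lt_one k hr
  have hsum : Summable fun n : ℕ => (μ ^ n * ((n : ℝ) + 3) ^ 2) ^ 2 := by
    refine (((hs 4).add ((hs 3).mul_left 12)).add (((hs 2).mul_left 54).add
      (((hs 1).mul_left 108).add ((hs 0).mul_left 81)))).congr fun n => ?_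
    rw [← pow_mul μ 2 n]
    ring
  exact ⟨_, L2Bound.of_summable hsum⟩

lemma sum_mul_eq_neg_sum_partial (f G u : ℕ → ℝ) (hG0 : G 0 = 0)
    (hG : ∀ k, G (k + 1) = G k + f (k + 1)) (hu : u 0 = 0) (N : ℕ) :
    ∑ k ∈ Finset.range (N + 1), f k * u k
      = G N * u (N + 1) - ∑ k ∈ Finset.range (N + 1), G k * du u k := by
  induction N with
  | zero => simp [hu, hG0]
  | succ n ih =>
    rw [Finset.sum_range_succ, ih, Finset.sum_range_succ _ (n + 1), hG, du]
    ring

/-- The partial sums of an element of the dual space stay `ℓ²`-close to a limit. -/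
lemma exists_limit_of_memUstar {f G : ℕ → ℝ} (hf : memUstar f) (hG0 : G 0 = 0)
    (hG : ∀ k, G (k + 1) = G k + f (k + 1)) :
    ∃ a M, L2Bound (fun k => a - G k) M := by
  obtain ⟨M, hM⟩ := hf
  have key : ∀ N : ℕ, ∃ a : ℝ, ∑ k ∈ Finset.range (N + 1), (a - G k) ^ 2 ≤ M ^ 2 := by
    intro N
    set a : ℝ := (∑ k ∈ Finset.range (N + 1), G k) / (N + 1) with ha
    have ha' : ∑ k ∈ Finset.range (N + 1), (a - G k) = 0 := by
      rw [Finset.sum_sub_distrib, Finset.sum_const, Finset.card_range, nsmul_eq_mul, ha]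
      push_cast
      field_simp
      ring
    let u : ℕ → ℝ := fun n => ∑ k ∈ Finset.range (min n (N + 1)), (a - G k)
    have hu0 : u 0 = 0 := by
      simp only [u, Nat.zero_min, Finset.range_zero, Finset.sum_empty]
    have huN : ∀ n, N + 1 ≤ n → u n = 0 := fun n hn => by
      simp only [u, min_eq_right hn, ha']
    have hdu : ∀ k, k < N + 1 → du u k = a - G k := fun k hk => by
      simp only [du, u]
      rw [min_eq_left hk.le, min_eq_left (Nat.succ_le_of_lt hk), Finset.sum_range_succ]
      ring
    have hdu0 : ∀ k, N + 1 ≤ k → du u k = 0 := fun k hk => by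
      simp [du, huN k hk, huN (k + 1) (by omega)]
    have hS : ∑' k, du u k ^ 2 = ∑ k ∈ Finset.range (N + 1), (a - G k) ^ 2 := by
      rw [tsum_eq_sum (s := Finset.range (N + 1))]
      · exact Finset.sum_congr rfl fun k hk => by rw [hdu k (Finset.mem_range.1 hk)]
      · intro k hk
        rw [hdu0 k (by simpa using hk)]
        simp
    have hF : ∑' k, f k * u k = ∑ k ∈ Finset.range (N + 1), (a - G k) ^ 2 := by
      rw [tsum_eq_sum (s := Finset.range (N + 1))]
      · rw [sum_mul_eq_neg_sum_partial f G u hG0 hG hu0, huN _ le_rfl]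
        have h1 : ∑ k ∈ Finset.range (N + 1), G k * du u k
            = ∑ k ∈ Finset.range (N + 1), (a * (a - G k) - (a - G k) ^ 2) :=
          Finset.sum_congr rfl fun k hk => by rw [hdu k (Finset.mem_range.1 hk)]; ring
        rw [h1, Finset.sum_sub_distrib, ← Finset.mul_sum, ha']
        ring
      · intro k hk
        rw [huN k (by simpa using hk)]
        simp
    have := hM u hu0 ⟨N + 1, huN⟩
    rw [hF, l2, hS] at this
    refine ⟨a, ?_⟩
    set S := ∑ k ∈ Finset.range (N + 1), (a - G k) ^ 2 with hSdef
    have hS0 : 0 ≤ S := Finset.sum_nonneg fun k _ => sq_nonneg _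
    have h1 := (le_abs_self S).trans this
    have h2 := Real.mul_self_sqrt hS0
    have h3 := Real.sqrt_nonneg S
    by_cases h0 : Real.sqrt S = 0
    · rw [h0] at h2
      nlinarith [sq_nonneg M]
    · have hpos : 0 < Real.sqrt S := lt_of_le_of_ne h3 (Ne.symm h0)
      have h4 : Real.sqrt S ≤ M := by
        by_contra! hlt
        nlinarith
      nlinarith
  have hne : (⋂ N : ℕ, {a : ℝ | ∑ k ∈ Finset.range (N + 1), (a - G k) ^ 2 ≤ M ^ 2}).Nonempty := by
    refine IsCompact.nonempty_iInter_of_sequence_nonempty_isCompact_isClosed _ ?_ key ?_ ?_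
    · intro N a ha
      rw [Set.mem_ofPred_eq] at ha ⊢
      refine le_trans ?_ ha
      exact Finset.sum_le_sum_of_subset_of_nonneg
        (Finset.range_mono (by omega)) fun k _ _ => sq_nonneg _
    · refine (isCompact_Icc (a := -|M|) (b := |M|)).of_isClosed_subset ?_ ?_
      · exact isClosed_le (by fun_prop) continuous_const
      · intro a ha
        simp only [Set.mem_ofPred_eq, zero_add, Finset.sum_range_one, hG0, sub_zero] at ha
        exact abs_le.1 (sq_le_sq.1 ha)
    · exact fun N => isClosed_le (by fun_prop) continuous_const
  obtain ⟨a, ha⟩ := hne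
  refine ⟨a, |M|, abs_nonneg M, fun N => ?_⟩
  rw [sq_abs]
  refine le_trans ?_ (Set.mem_iInter.1 ha N)
  exact Finset.sum_le_sum_of_subset_of_nonneg (Finset.range_mono (by omega))
    fun k _ _ => sq_nonneg _

lemma fAff_eq_of_mem_Icc (f : ℕ → ℝ) {n : ℕ} {x : ℝ} (hx : x ∈ Set.Icc (n : ℝ) (n + 1)) :
    fAff f x = f n + (x - n) * (f (n + 1) - f n) := by
  rcases eq_or_lt_of_le hx.2 with h | h
  · have hfl : ⌊x⌋₊ = n + 1 := by
      rw [h]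
      exact_mod_cast Nat.floor_natCast (R := ℝ) (n + 1)
    rw [fAff, hfl, h]
    push_cast
    ring
  · rw [fAff, (Nat.floor_eq_iff (n.cast_nonneg.trans hx.1)).2 ⟨hx.1, h⟩]

lemma exists_cell {x : ℝ} (hx : 0 ≤ x) : ∃ n : ℕ, x ∈ Set.Ico (n : ℝ) (n + 1) :=
  ⟨⌊x⌋₊, Nat.floor_le hx, Nat.lt_floor_add_one x⟩

lemma continuous_fAff (f : ℕ → ℝ) : Continuous (fAff f) := by
  have hcont : ∀ n : ℕ, Continuous fun x : ℝ => f n + (x - n) * (f (n + 1) - f n) :=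
    fun n => by fun_prop
  rw [continuous_iff_continuousAt]
  intro x
  have hfirst : x < 1 → ContinuousAt (fAff f) x := fun hx => by
    refine (hcont 0).continuousAt.congr ?_
    filter_upwards [Iio_mem_nhds hx] with y hy
    have : ⌊y⌋₊ = 0 := Nat.floor_eq_zero.2 hy
    simp [fAff, this]
  rcases lt_or_ge x 0 with hneg | hpos
  · exact hfirst (hneg.trans one_pos)
  obtain ⟨n, hn⟩ := exists_cell hpos
  rcases eq_or_lt_of_le hn.1 with h | h
  · rcases n with _ | m
    · exact hfirst (by rw [← h]; simp)
    · have hx : x = (m : ℝ) + 1 := by rw [← h]; push_cast; ring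
      rw [continuousAt_iff_continuous_left_right]
      constructor
      · refine (hcont m).continuousWithinAt.congr_of_eventuallyEq_of_mem ?_ Set.self_mem_Iic
        filter_upwards [self_mem_nhdsWithin, mem_nhdsWithin_of_mem_nhds
          (Ioi_mem_nhds (show (m : ℝ) < x by rw [hx]; linarith))] with y hy hy'
        exact fAff_eq_of_mem_Icc f ⟨le_of_lt hy', by rw [← hx]; exact hy⟩
      · refine (hcont (m + 1)).continuousWithinAt.congr_of_eventuallyEq_of_mem ?_ Set.self_mem_Ici
        filter_upwards [self_mem_nhdsWithin, mem_nhdsWithin_of_mem_nhds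
          (Iio_mem_nhds hn.2)] with y hy hy'
        exact fAff_eq_of_mem_Icc f ⟨by rw [h]; exact hy, le_of_lt hy'⟩
  · refine (hcont n).continuousAt.congr ?_
    filter_upwards [Ioo_mem_nhds h hn.2] with y hy
    exact (fAff_eq_of_mem_Icc f ⟨hy.1.le, hy.2.le⟩).symm

lemma integral_fAff_cell (f : ℕ → ℝ) {n : ℕ} {x : ℝ} (hx : x ∈ Set.Icc (n : ℝ) (n + 1)) :
    ∫ t in (n : ℝ)..x, fAff f t = (x - n) * f n + (x - n) ^ 2 / 2 * (f (n + 1) - f n) := by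
  have hd : ∀ t ∈ Set.uIcc (n : ℝ) x, HasDerivAt
      (fun t : ℝ => (t - n) * f n + (t - n) ^ 2 / 2 * (f (n + 1) - f n)) (fAff f t) t := by
    intro t ht
    rw [Set.uIcc_of_le hx.1] at ht
    rw [fAff_eq_of_mem_Icc f ⟨ht.1, ht.2.trans hx.2⟩]
    have h1 : HasDerivAt (fun t : ℝ => t - n) 1 t := (hasDerivAt_id t).sub_const (n : ℝ)
    refine ((h1.mul_const (f n)).add
      (((h1.pow 2).div_const 2).mul_const (f (n + 1) - f n))).congr_deriv ?_
    push_cast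
    ring
  rw [intervalIntegral.integral_eq_sub_of_hasDerivAt hd
    ((continuous_fAff f).intervalIntegrable _ _)]
  ring

lemma integral_fAff_nat (f : ℕ → ℝ) (K : ℕ) :
    ∫ t in (0 : ℝ)..K, fAff f t = f 0 / 2 + ∑ k ∈ Finset.range K, f (k + 1) - f K / 2 := by
  induction K with
  | zero => simp
  | succ n ih =>
    have hmem : ((n + 1 : ℕ) : ℝ) ∈ Set.Icc (n : ℝ) (n + 1) := by simp
    rw [← intervalIntegral.integral_add_adjacent_intervals
      ((continuous_fAff f).intervalIntegrable 0 n)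
      ((continuous_fAff f).intervalIntegrable n _), ih, integral_fAff_cell f hmem,
      Finset.sum_range_succ]
    push_cast
    ring

/-- Structure of a force in the dual space: its primitives and the piecewise affine primitive. -/
lemma memUstar.primitive {f : ℕ → ℝ} (hf : memUstar f) :
    (∃ M, L2Bound (gOf f) M) ∧ (Summable fun n => f n ^ 2) ∧
    (∀ x, HasDerivAt (gTilde f) (-fAff f x) x) ∧
    gTilde f 0 = f 0 / 2 + gOf f 0 ∧
    ∀ n : ℕ, gTilde f (n + 1 / 2) = gOf f n - (f (n + 1) - f n) / 8 := by
  obtain ⟨a, M, hM⟩ := exists_limit_of_memUstar (G := fun K => ∑ k ∈ Finset.range K, f (k + 1)) hf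
    (by simp) (fun k => Finset.sum_range_succ _ k)
  set G : ℕ → ℝ := fun K => ∑ k ∈ Finset.range K, f (k + 1) with hG
  have hGlim : Tendsto G atTop (nhds a) := by
    have h1 := hM.summable.tendsto_atTop_zero.sqrt
    simp only [Real.sqrt_sq_eq_abs, Real.sqrt_zero] at h1
    have h2 := (tendsto_zero_iff_abs_tendsto_zero _).2 h1
    simpa using h2.const_sub a
  have hg : ∀ l, gOf f l = a - G l := fun l => by
    refine Tendsto.limUnder_eq ?_
    rw [← tendsto_add_atTop_iff_nat 1]
    refine (hGlim.sub_const (G l)).congr' ?_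
    filter_upwards [eventually_ge_atTop l] with K hK
    rw [hG, ← Finset.sum_Ico_add' f l K 1, Finset.sum_Ico_eq_sub _ hK]
  have hfsucc : ∀ k, f (k + 1) = (a - G k) + (-1) * (a - G (k + 1)) := fun k => by
    simp only [hG, Finset.sum_range_succ]
    ring
  have hfsum : Summable fun n => f n ^ 2 := by
    rw [← summable_nat_add_iff 1]
    refine (L2Bound.add hM ((hM.shift 1).mono (a := fun k => (-1) * (a - G (k + 1)))
      fun n => show |(-1) * (a - G (n + 1))| ≤ |a - G (n + 1)| by
        rw [neg_one_mul, abs_neg])).summable.congr fun n => ?_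
    rw [hfsucc]
  have hf0 : Tendsto f atTop (nhds 0) := by
    have h1 := hfsum.tendsto_atTop_zero.sqrt
    simp only [Real.sqrt_sq_eq_abs, Real.sqrt_zero] at h1
    exact (tendsto_zero_iff_abs_tendsto_zero _).2 h1
  have hintegral : ∀ x y, IntervalIntegrable (fAff f) volume x y :=
    fun x y => (continuous_fAff f).intervalIntegrable x y
  have hgt : ∀ x, gTilde f x = f 0 / 2 + a - ∫ t in (0 : ℝ)..x, fAff f t := fun x => by
    refine Tendsto.limUnder_eq ?_
    have h1 : Tendsto (fun K : ℕ => f 0 / 2 + G K - f K / 2 - ∫ t in (0 : ℝ)..x, fAff f t) atTop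
        (nhds (f 0 / 2 + a - 0 / 2 - ∫ t in (0 : ℝ)..x, fAff f t)) :=
      ((hGlim.const_add _).sub (hf0.div_const 2)).sub_const _
    rw [zero_div, sub_zero] at h1
    refine h1.congr fun K => ?_
    rw [← integral_fAff_nat,
      intervalIntegral.integral_interval_sub_left (hintegral _ _) (hintegral _ _)]
  refine ⟨⟨M, by rwa [funext hg]⟩, hfsum, fun x => ?_, ?_, fun n => ?_⟩
  · rw [funext hgt]
    exact ((continuous_fAff f).integral_hasStrictDerivAt 0 x).hasDerivAt.const_sub _
  · rw [hgt, hg]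
    simp [hG]
  · have hmem : (n : ℝ) + 1 / 2 ∈ Set.Icc (n : ℝ) (n + 1) := ⟨by linarith, by linarith⟩
    rw [hgt, hg, ← intervalIntegral.integral_add_adjacent_intervals (hintegral 0 n) (hintegral n _),
      integral_fAff_nat, integral_fAff_cell f hmem]
    ring

lemma sum_integral_cells_le {h : ℝ → ℝ} (hnn : ∀ x, 0 ≤ h x)
    (hi : ∀ n : ℕ, IntervalIntegrable h volume n (n + 1)) {s : ℕ → ℝ} (hs : Summable s)
    (hle : ∀ n : ℕ, ∫ x in (n : ℝ)..n + 1, h x ≤ s n) (N : ℕ) :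
    ∑ n ∈ Finset.range N, ∫ x in (n : ℝ)..n + 1, h x ≤ ∫ x in Set.Ioi (0 : ℝ), h x := by
  have hi' : ∀ n : ℕ, IntervalIntegrable h volume (n : ℝ) ((n + 1 : ℕ) : ℝ) := fun n => by
    have := hi n
    rwa [← Nat.cast_succ] at this
  have hsum : ∀ N : ℕ, ∑ n ∈ Finset.range N, ∫ x in (n : ℝ)..n + 1, h x
      = ∫ x in (0 : ℝ)..N, h x := fun N => by
    have := intervalIntegral.sum_integral_adjacent_intervals (μ := volume) (f := h)
      (a := fun k : ℕ => (k : ℝ)) (n := N) fun k _ => hi' k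
    simpa using this
  have hs0 : ∀ n, 0 ≤ s n := fun n =>
    (intervalIntegral.integral_nonneg (by linarith) fun x _ => hnn x).trans (hle n)
  have hI : ∀ N : ℕ, IntervalIntegrable h volume 0 N := fun N => by
    have := IntervalIntegrable.trans_iterate (μ := volume) (f := h)
      (a := fun k : ℕ => (k : ℝ)) (n := N) fun k _ => hi' k
    simpa using this
  have hintegral : IntegrableOn h (Set.Ioi 0) := by
    refine integrableOn_Ioi_of_intervalIntegral_norm_bounded (∑' n, s n) 0
      (b := fun k : ℕ => (k : ℝ)) (l := atTop) (fun N => ?_) tendsto_natCast_atTop_atTop ?_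
    · exact (intervalIntegrable_iff_integrableOn_Ioc_of_le N.cast_nonneg).1 (hI N)
    · refine Eventually.of_forall fun N => ?_
      simp only [Real.norm_eq_abs, abs_of_nonneg (hnn _)]
      rw [← hsum]
      exact (Finset.sum_le_sum fun n _ => hle n).trans (hs.sum_le_tsum _ fun n _ => hs0 n)
  rw [hsum, intervalIntegral.integral_of_le N.cast_nonneg]
  exact setIntegral_mono_set hintegral (Eventually.of_forall hnn)
    (Eventually.of_forall fun x hx => hx.1)

/-- The Cauchy–Schwarz inequality on an interval of unit length. -/
lemma sq_integral_cell_le {g : ℝ → ℝ} {x : ℝ} (hg : ContinuousOn g (Set.Icc x (x + 1))) :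
    (∫ t in x..x + 1, g t) ^ 2 ≤ ∫ t in x..x + 1, g t ^ 2 := by
  have hx : x ≤ x + 1 := by linarith
  rw [← Set.uIcc_of_le hx] at hg
  set m := ∫ t in x..x + 1, g t with hm
  have h0 : 0 ≤ ∫ t in x..x + 1, (g t - m) ^ 2 :=
    intervalIntegral.integral_nonneg hx fun t _ => sq_nonneg _
  have h1 : ∫ t in x..x + 1, (g t - m) ^ 2
      = ∫ t in x..x + 1, ((g t ^ 2 - 2 * m * g t) + m ^ 2) :=
    intervalIntegral.integral_congr fun t _ => by ring
  have i1 : IntervalIntegrable (fun t => g t ^ 2) volume x (x + 1) := (hg.pow 2).intervalIntegrable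
  have i2 : IntervalIntegrable (fun t => 2 * m * g t) volume x (x + 1) :=
    (hg.const_mul _).intervalIntegrable
  rw [h1, intervalIntegral.integral_add (i1.sub i2) (by simp),
    intervalIntegral.integral_sub i1 i2, intervalIntegral.integral_const_mul, ← hm] at h0
  simp only [intervalIntegral.integral_const, add_sub_cancel_left, one_smul] at h0
  linarith

/-- The oscillation of a function on an interval is at most the `L¹` norm of its derivative. -/
lemma abs_sub_le_integral_abs_deriv {F F' : ℝ → ℝ} {a b : ℝ} (hab : a ≤ b)
    (hF : ContinuousOn F (Set.Icc a b)) (hF' : ContinuousOn F' (Set.Icc a b))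
    (hd : ∀ x ∈ Set.Ioo a b, HasDerivAt F (F' x) x) {x y : ℝ} (hx : x ∈ Set.Icc a b)
    (hy : y ∈ Set.Icc a b) : |F x - F y| ≤ ∫ t in a..b, |F' t| := by
  have key : ∀ x ∈ Set.Icc a b, ∀ y ∈ Set.Icc a b, x ≤ y →
      |F y - F x| ≤ ∫ t in a..b, |F' t| := by
    intro x hx y hy hxy
    have hsub : Set.Icc x y ⊆ Set.Icc a b := Set.Icc_subset_Icc hx.1 hy.2
    rw [← intervalIntegral.integral_eq_sub_of_hasDerivAt_of_le hxy (hF.mono hsub)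
      (fun t ht => hd t ⟨hx.1.trans_lt ht.1, ht.2.trans_le hy.2⟩)
      (ContinuousOn.intervalIntegrable (by rw [Set.uIcc_of_le hxy]; exact hF'.mono hsub))]
    refine (intervalIntegral.abs_integral_le_integral_abs hxy).trans ?_
    refine intervalIntegral.integral_mono_interval hx.1 hxy hy.2
      (Eventually.of_forall fun t => abs_nonneg (F' t)) ?_
    exact ContinuousOn.intervalIntegrable (by rw [Set.uIcc_of_le hab]; exact hF'.abs)
  rcases le_total x y with h | h
  · rw [abs_sub_comm]
    exact key x hx y hy h
  · exact key y hy x hx h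

/-- The cell average of a function close to an affine function is close to its midpoint value. -/
lemma abs_integral_sub_affine_le {w : ℝ → ℝ} {n α γ c M : ℝ}
    (hw : ContinuousOn w (Set.Icc n (n + 1)))
    (hM : ∀ x ∈ Set.Icc n (n + 1), |w x - (α + γ * (x - c))| ≤ M) :
    |(∫ t in n..n + 1, w t) - (α + γ * (n + 1 / 2 - c))| ≤ M := by
  have hn : n ≤ n + 1 := by linarith
  have h1 : ∫ t in n..n + 1, (α + γ * (t - c)) = α + γ * (n + 1 / 2 - c) := by
    rw [intervalIntegral.integral_add (by simp)
      ((by fun_prop : Continuous fun t : ℝ => γ * (t - c)).intervalIntegrable _ _),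
      intervalIntegral.integral_const_mul,
      intervalIntegral.integral_sub intervalIntegral.intervalIntegrable_id (by simp)]
    simp only [intervalIntegral.integral_const, integral_id, smul_eq_mul]
    ring
  rw [← h1, ← intervalIntegral.integral_sub
    (ContinuousOn.intervalIntegrable (by rwa [Set.uIcc_of_le hn]))
    ((by fun_prop : Continuous fun t : ℝ => α + γ * (t - c)).intervalIntegrable _ _)]
  have := intervalIntegral.norm_integral_le_of_norm_le_const (a := n) (b := n + 1) (C := M)
    (f := fun t => w t - (α + γ * (t - c))) fun t ht => hM t (by
      rw [Set.uIoc_of_le hn] at ht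
      exact ⟨ht.1.le, ht.2⟩)
  simpa using this

lemma SiteAssumptions.contDiff_dW {V : ℝ → ℝ → ℝ} {Vs : ℝ → ℝ} (h : SiteAssumptions V Vs) :
    ContDiff ℝ 2 (dW V) := by
  have h1 : ContDiff ℝ 3 (Wcb V) := h.smooth_V.comp (contDiff_id.prodMk contDiff_id)
  exact h1.deriv'

lemma SiteAssumptions.contDiff_d2W {V : ℝ → ℝ → ℝ} {Vs : ℝ → ℝ} (h : SiteAssumptions V Vs) :
    ContDiff ℝ 1 (d2W V) :=
  ContDiff.deriv' (n := 1) h.contDiff_dW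

lemma abs_deriv_le_of_abs_sub_le {g : ℝ → ℝ} {K : ℝ} (hK : 0 ≤ K)
    (h : ∀ x y, |g x - g y| ≤ K * |x - y|) (x : ℝ) : |deriv g x| ≤ K := by
  rw [← Real.norm_eq_abs]
  exact norm_deriv_le_of_lip' hK (Eventually.of_forall fun y => h y x)

/-- A coercive weighted `L²` form with continuous weight has a pointwise coercive weight. -/
lemma le_of_integral_coercive {Q : ℝ → ℝ} {c : ℝ} (hQ : ContinuousOn Q (Set.Ici 0))
    (hco : ∀ v : ℝ → ℝ, MemLp v 2 (volume.restrict (Set.Ioi 0)) →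
      c * ∫ x in Set.Ioi (0 : ℝ), v x ^ 2 ≤ ∫ x in Set.Ioi (0 : ℝ), Q x * v x ^ 2)
    {x : ℝ} (hx : 0 ≤ x) : c ≤ Q x := by
  by_contra! hlt
  obtain ⟨c', hc1, hc2⟩ := exists_between hlt
  have hev : ∀ᶠ y in nhdsWithin x (Set.Ici 0), Q y < c' := (hQ x hx).eventually_lt_const hc1
  obtain ⟨δ, hδ, hball⟩ := Metric.mem_nhdsWithin_iff.1 hev
  have hle : x ≤ x + δ / 2 := by linarith
  have hsub : Set.Icc x (x + δ / 2) ⊆ Set.Ici 0 := fun y hy => hx.trans hy.1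
  have hsub' : Set.Ioc x (x + δ / 2) ⊆ Set.Ioi 0 := fun y hy => hx.trans_lt hy.1
  have hQc : ∀ y ∈ Set.Icc x (x + δ / 2), Q y ≤ c' := fun y hy => by
    refine le_of_lt (hball ⟨?_, hsub hy⟩)
    rw [Metric.mem_ball, Real.dist_eq, abs_of_nonneg (by linarith [hy.1])]
    linarith [hy.2]
  set v : ℝ → ℝ := (Set.Ioc x (x + δ / 2)).indicator fun _ => 1 with hv
  have hv2 : ∀ y, v y ^ 2 = (Set.Ioc x (x + δ / 2)).indicator (fun _ => (1 : ℝ)) y := fun y => by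
    simp only [hv, Set.indicator_apply]
    split_ifs <;> norm_num
  have hQv : ∀ y, Q y * v y ^ 2 = (Set.Ioc x (x + δ / 2)).indicator Q y := fun y => by
    rw [hv2]
    simp only [Set.indicator_apply]
    split_ifs <;> simp
  have hmem : MemLp v 2 (volume.restrict (Set.Ioi 0)) :=
    memLp_indicator_const 2 measurableSet_Ioc 1 (Or.inr (by
      refine ne_of_lt ((Measure.restrict_apply_le _ _).trans_lt ?_)
      simp))
  have key := hco v hmem
  simp only [hQv] at key
  simp only [hv2] at key
  rw [setIntegral_indicator measurableSet_Ioc, setIntegral_indicator measurableSet_Ioc,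
    Set.inter_eq_self_of_subset_right hsub', ← intervalIntegral.integral_of_le hle,
    ← intervalIntegral.integral_of_le hle] at key
  have h1 : ∫ y in x..x + δ / 2, Q y ≤ ∫ _ in x..x + δ / 2, c' :=
    intervalIntegral.integral_mono_on hle
      (ContinuousOn.intervalIntegrable (by rw [Set.uIcc_of_le hle]; exact hQ.mono hsub))
      (by simp) hQc
  simp only [intervalIntegral.integral_const, smul_eq_mul, add_sub_cancel_left] at h1 key
  nlinarith

/-- Pointwise form of the Cauchy–Born equation and of its derivative. -/
lemma CBSolution.pointwise {V : ℝ → ℝ → ℝ} {Vs : ℝ → ℝ} (h : SiteAssumptions V Vs)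
    {f : ℕ → ℝ} (hf : memUstar f) {Cw : ℝ} {w w1 w2 : ℝ → ℝ} (hcb : CBSolution V f Cw w w1 w2) :
    (∃ c, 0 < c ∧ ∀ x, 0 ≤ x → c ≤ d2W V (w x)) ∧
    (∀ x, 0 ≤ x → dW V (w x) = gTilde f x) ∧
    ∀ x, 0 ≤ x → w1 x * d2W V (w x) = -fAff f x := by
  obtain ⟨-, heq, ⟨c, hc, hco⟩, hw, -, -⟩ := hcb
  obtain ⟨-, -, hg, -, -⟩ := hf.primitive
  have hwc : ContinuousOn w (Set.Ici 0) := fun x hx => (hw x hx).continuousAt.continuousWithinAt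
  have hdW : ∀ F, HasDerivAt (dW V) (d2W V F) F := fun F =>
    (h.contDiff_dW.differentiable (by norm_num) F).hasDerivAt
  have heqOn : Set.EqOn (fun x => dW V (w x)) (gTilde f) (Set.Ici 0) := by
    refine Measure.eqOn_of_ae_eq (μ := volume) ?_
      (h.contDiff_dW.continuous.comp_continuousOn hwc)
      (fun x _ => (hg x).continuousAt.continuousWithinAt) ?_
    · rw [← Measure.restrict_congr_set Ioi_ae_eq_Ici]
      exact heq
    · rw [interior_Ici, closure_Ioi]
  refine ⟨⟨c, hc, fun x hx => le_of_integral_coercive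
    (h.contDiff_d2W.continuous.comp_continuousOn hwc) hco hx⟩, heqOn, fun x hx => ?_⟩
  have h1 : HasDerivWithinAt (fun x => dW V (w x)) (d2W V (w x) * w1 x) (Set.Ici 0) x :=
    ((hdW (w x)).comp x (hw x hx)).hasDerivWithinAt
  have h2 : HasDerivWithinAt (fun x => dW V (w x)) (-fAff f x) (Set.Ici 0) x :=
    (hg x).hasDerivWithinAt.congr heqOn (heqOn hx)
  rw [mul_comm]
  exact (uniqueDiffOn_Ici (0 : ℝ) x hx).eq_deriv _ h1 h2

/-- The strain gradient is continuously differentiable on every closed lattice cell. -/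
lemma CBSolution.cell_derivative {V : ℝ → ℝ → ℝ} {Vs : ℝ → ℝ} (h : SiteAssumptions V Vs)
    {f : ℕ → ℝ} (hf : memUstar f) {Cw : ℝ} {w w1 w2 : ℝ → ℝ} (hcb : CBSolution V f Cw w w1 w2) :
    ContinuousOn w1 (Set.Ici 0) ∧ ∀ n : ℕ, ∃ D : ℝ → ℝ,
      (∀ x, D x = (-(f (n + 1) - f n) - w1 x * (deriv (d2W V) (w x) * w1 x)) / d2W V (w x)) ∧
      ContinuousOn D (Set.Icc (n : ℝ) (n + 1)) ∧
      ∀ x ∈ Set.Ioo (n : ℝ) (n + 1), HasDerivAt w1 (D x) x := by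
  obtain ⟨⟨c, hc, hcQ⟩, -, hw1⟩ := hcb.pointwise h hf
  obtain ⟨-, -, -, hw, -, -⟩ := hcb
  have hwc : ContinuousOn w (Set.Ici 0) := fun x hx => (hw x hx).continuousAt.continuousWithinAt
  have hQ0 : ∀ x, 0 ≤ x → d2W V (w x) ≠ 0 := fun x hx => (hc.trans_le (hcQ x hx)).ne'
  have hw1' : ∀ x, 0 ≤ x → w1 x = -fAff f x / d2W V (w x) := fun x hx => by
    rw [eq_div_iff (hQ0 x hx), hw1 x hx]
  have hQc : ContinuousOn (fun x => d2W V (w x)) (Set.Ici 0) :=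
    h.contDiff_d2W.continuous.comp_continuousOn hwc
  have hw1c : ContinuousOn w1 (Set.Ici 0) :=
    ((continuous_fAff f).neg.continuousOn.div hQc hQ0).congr hw1'
  refine ⟨hw1c, fun n => ⟨_, fun x => rfl, ?_, fun x hx => ?_⟩⟩
  · have hsub : Set.Icc (n : ℝ) (n + 1) ⊆ Set.Ici 0 := fun x hx => n.cast_nonneg.trans hx.1
    have h3 : ContinuousOn (fun x => deriv (d2W V) (w x)) (Set.Ici 0) :=
      (h.contDiff_d2W.continuous_deriv le_rfl).comp_continuousOn hwc
    exact ((continuousOn_const.sub (hw1c.mul (h3.mul hw1c))).div hQc hQ0).mono hsub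
  · have hx0 : 0 ≤ x := n.cast_nonneg.trans hx.1.le
    have hQd : HasDerivAt (fun x => d2W V (w x)) (deriv (d2W V) (w x) * w1 x) x :=
      (h.contDiff_d2W.differentiable (by norm_num) (w x)).hasDerivAt.comp x (hw x hx0)
    have hnum : HasDerivAt (fun x : ℝ => -(f n + (x - n) * (f (n + 1) - f n)))
        (-(f (n + 1) - f n)) x :=
      (((((hasDerivAt_id x).sub_const (n : ℝ)).mul_const (f (n + 1) - f n)).const_add
        (f n)).neg).congr_deriv (by ring)
    have hval : -(f n + (x - n) * (f (n + 1) - f n)) = w1 x * d2W V (w x) := by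
      rw [hw1 x hx0, fAff_eq_of_mem_Icc f ⟨hx.1.le, hx.2.le⟩]
    have hdiv := hnum.div hQd (hQ0 x hx0)
    rw [hval] at hdiv
    refine (hdiv.congr_of_eventuallyEq ?_).congr_deriv ?_
    · filter_upwards [Ioo_mem_nhds hx.1 hx.2] with y hy
      rw [hw1' y (n.cast_nonneg.trans hy.1.le), fAff_eq_of_mem_Icc f ⟨hy.1.le, hy.2.le⟩]
      rfl
    · have := hQ0 x hx0
      field_simp

lemma abs_fAff_le (f : ℕ → ℝ) {n : ℕ} {x : ℝ} (hx : x ∈ Set.Icc (n : ℝ) (n + 1)) :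
    |fAff f x| ≤ |f n| + |f (n + 1)| := by
  rw [fAff_eq_of_mem_Icc f hx,
    show f n + (x - n) * (f (n + 1) - f n) = (n + 1 - x) * f n + (x - n) * f (n + 1) by ring]
  refine (abs_add_le _ _).trans ?_
  have h0 : 0 ≤ (n : ℝ) + 1 - x := by linarith [hx.2]
  have h1 : 0 ≤ x - n := by linarith [hx.1]
  rw [abs_mul, abs_mul, abs_of_nonneg h0, abs_of_nonneg h1]
  nlinarith [abs_nonneg (f n), abs_nonneg (f (n + 1)), hx.1, hx.2]

/-- Lattice differences are controlled by the derivative of the affine interpolant. -/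
lemma l2Bound_sub_fAff {f : ℕ → ℝ} (hf : Summable fun n => f n ^ 2) :
    L2Bound (fun n => f (n + 1) - f n)
      (Real.sqrt (∫ x in Set.Ioi (0 : ℝ), deriv (fAff f) x ^ 2)) := by
  have hd : ∀ n : ℕ, ∀ x ∈ Set.Ioo (n : ℝ) (n + 1), deriv (fAff f) x = f (n + 1) - f n := by
    intro n x hx
    have h1 : HasDerivAt (fun x : ℝ => f n + (x - n) * (f (n + 1) - f n)) (f (n + 1) - f n) x :=
      ((((hasDerivAt_id x).sub_const (n : ℝ)).mul_const (f (n + 1) - f n)).const_add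
        (f n)).congr_deriv (by ring)
    refine (h1.congr_of_eventuallyEq ?_).deriv
    filter_upwards [Ioo_mem_nhds hx.1 hx.2] with y hy
    exact fAff_eq_of_mem_Icc f ⟨hy.1.le, hy.2.le⟩
  have hle : ∀ n : ℕ, (n : ℝ) ≤ n + 1 := fun n => by linarith
  have hc : ∀ n : ℕ, ∫ x in (n : ℝ)..n + 1, deriv (fAff f) x ^ 2 = (f (n + 1) - f n) ^ 2 :=
    fun n => by
    rw [intervalIntegral.integral_of_le (hle n), integral_Ioc_eq_integral_Ioo,
      setIntegral_congr_fun measurableSet_Ioo (g := fun _ => (f (n + 1) - f n) ^ 2)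
        (fun x hx => by simp only [hd n x hx]),
      ← integral_Ioc_eq_integral_Ioo, ← intervalIntegral.integral_of_le (hle n)]
    simp
  have hi : ∀ n : ℕ,
      IntervalIntegrable (fun x => deriv (fAff f) x ^ 2) volume (n : ℝ) (n + 1) := fun n => by
    refine (intervalIntegrable_const (c := (f (n + 1) - f n) ^ 2)).congr_uIoo fun x hx => ?_
    rw [Set.uIoo_of_le (hle n)] at hx
    simp only [hd n x hx]
  have hs : Summable fun n => (f (n + 1) - f n) ^ 2 := by
    have hL := L2Bound.of_summable hf
    refine ((hL.shift 1).abs.add hL.abs).mono' (fun n => abs_sub _ _) |>.summable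
  refine ⟨Real.sqrt_nonneg _, fun N => ?_⟩
  rw [Real.sq_sqrt (integral_nonneg fun x => sq_nonneg _)]
  simpa only [hc] using
    sum_integral_cells_le (fun x => sq_nonneg (deriv (fAff f) x)) hi hs (fun n => (hc n).le) N

/-- Oscillation of the strain gradient over the lattice cells. -/
lemma CBSolution.exists_oscillation_bound_gradient {V : ℝ → ℝ → ℝ} {Vs : ℝ → ℝ}
    (h : SiteAssumptions V Vs) {K : ℝ} (hK : SiteBounds V Vs K) {f : ℕ → ℝ} (hf : memUstar f)
    {Cw : ℝ} {w w1 w2 : ℝ → ℝ} (hcb : CBSolution V f Cw w w1 w2) :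
    ∃ b : ℕ → ℝ, L2Bound b (Real.sqrt (∫ x in Set.Ioi (0 : ℝ), w2 x ^ 2)) ∧
      ∀ n : ℕ, ∀ x ∈ Set.Icc (n : ℝ) (n + 1), ∀ y ∈ Set.Icc (n : ℝ) (n + 1),
        |w1 x - w1 y| ≤ b n := by
  obtain ⟨⟨c, hc, hcQ⟩, -, hw1⟩ := hcb.pointwise h hf
  obtain ⟨hw1c, hD⟩ := hcb.cell_derivative h hf
  obtain ⟨-, hfs, -, -, -⟩ := hf.primitive
  choose D hDeq hDc hDd using hD
  have hfL := L2Bound.of_summable hfs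
  set σ : ℕ → ℝ := fun n => |f n| + |f (n + 1)| with hσ
  have hσL : L2Bound σ (l2 f + l2 f) := hfL.abs.add (hfL.abs.shift 1)
  have hσ0 : ∀ n, 0 ≤ σ n := fun n => by positivity
  have hle : ∀ n : ℕ, (n : ℝ) ≤ n + 1 := fun n => by linarith
  have hw1b : ∀ n : ℕ, ∀ x ∈ Set.Icc (n : ℝ) (n + 1), |w1 x| * c ≤ σ n := fun n x hx => by
    have hx0 : 0 ≤ x := n.cast_nonneg.trans hx.1
    refine le_trans ?_ (abs_fAff_le f hx)
    rw [← abs_neg (fAff f x), ← hw1 x hx0, abs_mul]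
    exact mul_le_mul_of_nonneg_left ((hcQ x hx0).trans (le_abs_self _)) (abs_nonneg _)
  set A : ℝ := (1 + K * ((l2 f + l2 f) / c ^ 2)) / c with hA
  have hDb : ∀ n : ℕ, ∀ x ∈ Set.Icc (n : ℝ) (n + 1), |D n x| ≤ A * σ n := fun n x hx => by
    have hx0 : 0 ≤ x := n.cast_nonneg.trans hx.1
    have hQ := hcQ x hx0
    have hQ0 := hc.trans_le hQ
    have h1 : |deriv (d2W V) (w x)| ≤ K := abs_deriv_le_of_abs_sub_le hK.nonneg hK.d2W_lip _
    have h2 : |w1 x| ≤ σ n / c := (le_div_iff₀ hc).2 (hw1b n x hx)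
    have h3 : w1 x ^ 2 ≤ (l2 f + l2 f) / c ^ 2 * σ n := by
      rw [← sq_abs]
      calc |w1 x| ^ 2 ≤ (σ n / c) ^ 2 := pow_le_pow_left₀ (abs_nonneg _) h2 2
        _ = σ n / c ^ 2 * σ n := by ring
        _ ≤ _ := mul_le_mul_of_nonneg_right (div_le_div_of_nonneg_right
          ((le_abs_self _).trans (hσL.abs_le n)) (sq_nonneg c)) (hσ0 n)
    have h4 : |-(f (n + 1) - f n) - w1 x * (deriv (d2W V) (w x) * w1 x)|
        ≤ σ n + K * ((l2 f + l2 f) / c ^ 2 * σ n) := by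
      refine (abs_sub _ _).trans (add_le_add ?_ ?_)
      · rw [abs_neg, hσ]
        exact (abs_sub _ _).trans_eq (add_comm _ _)
      · rw [show w1 x * (deriv (d2W V) (w x) * w1 x) = deriv (d2W V) (w x) * w1 x ^ 2 by ring,
          abs_mul, abs_of_nonneg (sq_nonneg (w1 x))]
        exact mul_le_mul h1 h3 (sq_nonneg _) hK.nonneg
    rw [hDeq, abs_div, div_le_iff₀ (abs_pos.2 hQ0.ne')]
    refine h4.trans ?_
    have hA0 : 0 ≤ A * σ n := by
      have := hK.nonneg
      have := hfL.1
      have := hσ0 n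
      positivity
    calc σ n + K * ((l2 f + l2 f) / c ^ 2 * σ n) = A * σ n * c := by
          rw [hA]
          field_simp
      _ ≤ _ := mul_le_mul_of_nonneg_left (hQ.trans (le_abs_self _)) hA0
  have hae : ∀ n : ℕ, (fun x => D n x ^ 2) =ᵐ[volume.restrict (Set.Ioc (n : ℝ) (n + 1))]
      fun x => w2 x ^ 2 := fun n => by
    have h1 : ∀ᵐ x ∂(volume.restrict (Set.Ioo (n : ℝ) (n + 1))), HasDerivAt w1 (w2 x) x :=
      ae_restrict_of_ae_restrict_of_subset
        (fun x hx => lt_of_le_of_lt n.cast_nonneg hx.1) hcb.2.2.2.2.1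
    rw [← Measure.restrict_congr_set Ioo_ae_eq_Ioc]
    filter_upwards [h1, ae_restrict_mem measurableSet_Ioo] with x hx hx'
    rw [hx.unique (hDd n x hx')]
  have hDi : ∀ n : ℕ, IntervalIntegrable (fun x => D n x ^ 2) volume (n : ℝ) (n + 1) := fun n =>
    ContinuousOn.intervalIntegrable (by rw [Set.uIcc_of_le (hle n)]; exact (hDc n).pow 2)
  have hintegral : ∀ n : ℕ, ∫ x in (n : ℝ)..n + 1, w2 x ^ 2 = ∫ x in (n : ℝ)..n + 1, D n x ^ 2 :=
    fun n => by
    rw [intervalIntegral.integral_of_le (hle n), intervalIntegral.integral_of_le (hle n)]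
    exact (integral_congr_ae (hae n)).symm
  have hi : ∀ n : ℕ, IntervalIntegrable (fun x => w2 x ^ 2) volume (n : ℝ) (n + 1) := fun n => by
    refine (hDi n).congr_ae ?_
    rw [Set.uIoc_of_le (hle n)]
    exact hae n
  have hs : Summable fun n => A ^ 2 * σ n ^ 2 := hσL.summable.mul_left _
  have hbd : ∀ n : ℕ, ∫ x in (n : ℝ)..n + 1, w2 x ^ 2 ≤ A ^ 2 * σ n ^ 2 := fun n => by
    rw [hintegral]
    refine (intervalIntegral.integral_mono_on (hle n) (hDi n)
      (intervalIntegrable_const (c := A ^ 2 * σ n ^ 2)) fun x hx => ?_).trans (by simp)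
    rw [← mul_pow]
    exact sq_le_sq' (abs_le.1 (hDb n x hx)).1 (abs_le.1 (hDb n x hx)).2
  have hnn : ∀ n : ℕ, 0 ≤ ∫ x in (n : ℝ)..n + 1, w2 x ^ 2 := fun n =>
    intervalIntegral.integral_nonneg (hle n) fun x _ => sq_nonneg _
  refine ⟨fun n => Real.sqrt (∫ x in (n : ℝ)..n + 1, w2 x ^ 2),
    ⟨Real.sqrt_nonneg _, fun N => ?_⟩, fun n x hx y hy => ?_⟩
  · rw [Real.sq_sqrt (integral_nonneg fun x => sq_nonneg _)]
    simp only [Real.sq_sqrt (hnn _)]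
    exact sum_integral_cells_le (fun x => sq_nonneg (w2 x)) hi hs hbd N
  · refine (abs_sub_le_integral_abs_deriv (hle n)
      (hw1c.mono fun x hx => n.cast_nonneg.trans hx.1) (hDc n) (hDd n) hx hy).trans
      (Real.le_sqrt_of_sq_le ((sq_integral_cell_le (hDc n).abs).trans ?_))
    simp only [sq_abs, hintegral, le_refl]

/-- Oscillation of the strain over the lattice cells. -/
lemma CBSolution.exists_oscillation_bound_strain {V : ℝ → ℝ → ℝ} {Vs : ℝ → ℝ}
    (h : SiteAssumptions V Vs) {f : ℕ → ℝ} (hf : memUstar f)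
    {Cw : ℝ} {w w1 w2 : ℝ → ℝ} (hcb : CBSolution V f Cw w w1 w2) :
    ∃ a : ℕ → ℝ, L2Bound (fun n => a n ^ 2) (Real.sqrt (∫ x in Set.Ioi (0 : ℝ), w1 x ^ 4)) ∧
      ∀ n : ℕ, ∀ x ∈ Set.Icc (n : ℝ) (n + 1), ∀ y ∈ Set.Icc (n : ℝ) (n + 1),
        |w x - w y| ≤ a n := by
  obtain ⟨⟨c, hc, hcQ⟩, -, hw1⟩ := hcb.pointwise h hf
  obtain ⟨hw1c, -⟩ := hcb.cell_derivative h hf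
  obtain ⟨-, hfs, -, -, -⟩ := hf.primitive
  have hw := hcb.2.2.2.1
  have hfL := L2Bound.of_summable hfs
  set σ : ℕ → ℝ := fun n => |f n| + |f (n + 1)| with hσ
  have hσL : L2Bound σ (l2 f + l2 f) := hfL.abs.add (hfL.abs.shift 1)
  have hle : ∀ n : ℕ, (n : ℝ) ≤ n + 1 := fun n => by linarith
  have hsub : ∀ n : ℕ, Set.Icc (n : ℝ) (n + 1) ⊆ Set.Ici 0 :=
    fun n x hx => n.cast_nonneg.trans hx.1
  have hw1b : ∀ n : ℕ, ∀ x ∈ Set.Icc (n : ℝ) (n + 1), |w1 x| ≤ σ n / c := fun n x hx => by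
    have hx0 : 0 ≤ x := n.cast_nonneg.trans hx.1
    rw [le_div_iff₀ hc]
    refine le_trans ?_ (abs_fAff_le f hx)
    rw [← abs_neg (fAff f x), ← hw1 x hx0, abs_mul]
    exact mul_le_mul_of_nonneg_left ((hcQ x hx0).trans (le_abs_self _)) (abs_nonneg _)
  have hi : ∀ k n : ℕ, IntervalIntegrable (fun x => w1 x ^ k) volume (n : ℝ) (n + 1) :=
    fun k n => ContinuousOn.intervalIntegrable
      (by rw [Set.uIcc_of_le (hle n)]; exact (hw1c.mono (hsub n)).pow k)
  set B : ℝ := (l2 f + l2 f) ^ 2 / c ^ 4 with hB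
  have hs : Summable fun n => B * σ n ^ 2 := hσL.summable.mul_left _
  have hbd : ∀ n : ℕ, ∫ x in (n : ℝ)..n + 1, w1 x ^ 4 ≤ B * σ n ^ 2 := fun n => by
    refine (intervalIntegral.integral_mono_on (hle n) (hi 4 n)
      (intervalIntegrable_const (c := B * σ n ^ 2)) fun x hx => ?_).trans (by simp)
    have h1 : w1 x ^ 2 ≤ (σ n / c) ^ 2 := by
      rw [← sq_abs]
      exact pow_le_pow_left₀ (abs_nonneg _) (hw1b n x hx) 2
    have h2 : σ n ^ 2 ≤ (l2 f + l2 f) ^ 2 := by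
      rw [← sq_abs]
      exact pow_le_pow_left₀ (abs_nonneg _) (hσL.abs_le n) 2
    calc w1 x ^ 4 = (w1 x ^ 2) ^ 2 := by ring
      _ ≤ ((σ n / c) ^ 2) ^ 2 := pow_le_pow_left₀ (sq_nonneg _) h1 2
      _ = σ n ^ 2 / c ^ 4 * σ n ^ 2 := by ring
      _ ≤ B * σ n ^ 2 := mul_le_mul_of_nonneg_right
          (div_le_div_of_nonneg_right h2 (by positivity)) (sq_nonneg _)
  refine ⟨fun n => ∫ x in (n : ℝ)..n + 1, |w1 x|, ⟨Real.sqrt_nonneg _, fun N => ?_⟩,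
    fun n x hx y hy => abs_sub_le_integral_abs_deriv (hle n)
      (fun z hz => (hw z (hsub n hz)).continuousAt.continuousWithinAt) (hw1c.mono (hsub n))
      (fun z hz => hw z (hsub n ⟨hz.1.le, hz.2.le⟩)) hx hy⟩
  have h4 : ∀ x, 0 ≤ w1 x ^ 4 := fun x => by positivity
  rw [Real.sq_sqrt (integral_nonneg h4)]
  refine (Finset.sum_le_sum fun n _ => ?_).trans (sum_integral_cells_le h4 (hi 4) hs hbd N)
  have h1 := sq_integral_cell_le (hw1c.mono (hsub n)).abs
  have h2 := sq_integral_cell_le ((hw1c.mono (hsub n)).pow 2)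
  simp only [sq_abs, Pi.pow_apply] at h1 h2
  refine (pow_le_pow_left₀ (sq_nonneg _) h1 2).trans (h2.trans_eq ?_)
  simp only [← pow_mul, Nat.reduceMul]

lemma abs_sub_affine_le {w w1 : ℝ → ℝ} {s : Set ℝ} {B c x : ℝ} (hs : Convex ℝ s)
    (hw : ∀ y ∈ s, HasDerivAt w (w1 y) y) (hB : ∀ y ∈ s, |w1 y - w1 c| ≤ B) (hc : c ∈ s)
    (hx : x ∈ s) : |w x - (w c + w1 c * (x - c))| ≤ B * |x - c| := by
  have hd : ∀ y ∈ s, HasDerivWithinAt (fun y => w y - w1 c * (y - c)) (w1 y - w1 c) s y :=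
    fun y hy => ((hw y hy).sub ((((hasDerivAt_id y).sub_const c).const_mul (w1 c)).congr_deriv
      (mul_one _))).hasDerivWithinAt
  have key := hs.norm_image_sub_le_of_norm_hasDerivWithin_le hd hB hc hx
  simp only [sub_self, mul_zero, sub_zero, Real.norm_eq_abs] at key
  rwa [show w x - (w c + w1 c * (x - c)) = w x - w1 c * (x - c) - w c by ring]

lemma abs_PiA_sub_affine_le {w : ℝ → ℝ} (hw : ContinuousOn w (Set.Ici 0)) {n : ℕ} {α γ c M : ℝ}
    (hM : ∀ x ∈ Set.Icc (n : ℝ) (n + 1), |w x - (α + γ * (x - c))| ≤ M) :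
    |PiA w n - (α + γ * (n + 1 / 2 - c))| ≤ M :=
  abs_integral_sub_affine_le (hw.mono fun _ hx => n.cast_nonneg.trans hx.1) hM

lemma abs_PiA_sub_le {w : ℝ → ℝ} (hw : ContinuousOn w (Set.Ici 0)) {n : ℕ} {α M : ℝ}
    (hM : ∀ x ∈ Set.Icc (n : ℝ) (n + 1), |w x - α| ≤ M) : |PiA w n - α| ≤ M := by
  simpa using abs_PiA_sub_affine_le hw (α := α) (γ := 0) (c := 0) (by simpa using hM)

lemma abs_PiA_succ_sub_le {w : ℝ → ℝ} (hw : ContinuousOn w (Set.Ici 0)) {a : ℕ → ℝ}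
    (ha : ∀ n : ℕ, ∀ x ∈ Set.Icc (n : ℝ) (n + 1), ∀ y ∈ Set.Icc (n : ℝ) (n + 1),
      |w x - w y| ≤ a n) (n : ℕ) : |PiA w (n + 1) - PiA w n| ≤ a n + a (n + 1) := by
  have h0 : |PiA w n - w (n + 1)| ≤ a n :=
    abs_PiA_sub_le hw fun x hx => ha n x hx _ ⟨by linarith, le_rfl⟩
  have h1 : |PiA w (n + 1) - w (n + 1)| ≤ a (n + 1) :=
    abs_PiA_sub_le hw fun x hx => ha (n + 1) x hx _ ⟨by push_cast; rfl, by push_cast; linarith⟩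
  rw [abs_le] at *
  constructor <;> linarith [h0.1, h0.2, h1.1, h1.2]

/-- The projected strain drifts away from the boundary strain at most quadratically. -/
lemma abs_PiA_sub_boundary_le {w w1 : ℝ → ℝ} (hw : ∀ x ∈ Set.Ici (0 : ℝ), HasDerivAt w (w1 x) x)
    {b : ℕ → ℝ} {B : ℝ} (hbB : L2Bound b B)
    (hb : ∀ n : ℕ, ∀ x ∈ Set.Icc (n : ℝ) (n + 1), ∀ y ∈ Set.Icc (n : ℝ) (n + 1),
      |w1 x - w1 y| ≤ b n) (n : ℕ) : |PiA w n - w 0| ≤ ((n : ℝ) + 1) ^ 2 * (|w1 0| + B) := by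
  have hbB' : ∀ n, b n ≤ B := fun n => (le_abs_self _).trans (hbB.abs_le n)
  have hnode : ∀ n : ℕ, |w1 n - w1 0| ≤ n * B := by
    intro n
    induction n with
    | zero => simp
    | succ k ih =>
      have h1 := hb k (k + 1) ⟨by linarith, le_rfl⟩ k ⟨le_rfl, by linarith⟩
      have h2 := hbB' k
      push_cast
      rw [abs_le] at *
      constructor <;> linarith [h1.1, h1.2, ih.1, ih.2]
  have hcell : ∀ n : ℕ, ∀ x ∈ Set.Icc (n : ℝ) (n + 1), |w1 x - w1 0| ≤ (n + 1) * B := by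
    intro n x hx
    have h1 := hb n x hx n ⟨le_rfl, by linarith⟩
    have h2 := hbB' n
    have h3 := hnode n
    rw [abs_le] at *
    constructor <;> linarith [h1.1, h1.2, h3.1, h3.2]
  refine abs_PiA_sub_le (fun x hx => (hw x hx).continuousAt.continuousWithinAt) fun x hx => ?_
  have hx0 : (0 : ℝ) ≤ x := n.cast_nonneg.trans hx.1
  have hn : (0 : ℝ) ≤ n := n.cast_nonneg
  have hB := hbB.1
  have key := abs_sub_affine_le (w := w) (w1 := w1) (B := (n + 1) * B) (c := 0) (x := x)
    (convex_Icc (0 : ℝ) (n + 1)) (fun y hy => hw y hy.1) (fun y hy => by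
      rcases hy.2.lt_or_eq with hlt | heq
      · obtain ⟨m, hm⟩ := exists_cell hy.1
        refine (hcell m y ⟨hm.1, hm.2.le⟩).trans (mul_le_mul_of_nonneg_right ?_ hB)
        have : m < n + 1 := by exact_mod_cast hm.1.trans_lt hlt
        exact_mod_cast this
      · rw [heq]
        exact_mod_cast hnode (n + 1)) ⟨le_rfl, by linarith⟩ ⟨hx0, hx.2⟩
  rw [sub_zero, abs_of_nonneg hx0] at key
  have h1 : |w1 0 * x| ≤ |w1 0| * (n + 1) := by
    rw [abs_mul, abs_of_nonneg hx0]
    exact mul_le_mul_of_nonneg_left hx.2 (abs_nonneg _)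
  have h2 : (n + 1) * B * x ≤ (n + 1) * B * (n + 1) :=
    mul_le_mul_of_nonneg_left hx.2 (by positivity)
  have h3 : |w1 0| * (n + 1) ≤ (n + 1) ^ 2 * |w1 0| := by
    nlinarith [abs_nonneg (w1 0), mul_nonneg (mul_nonneg hn (abs_nonneg (w1 0))) hn]
  rw [abs_le] at *
  constructor <;> nlinarith [h1.1, h1.2, key.1, key.2]

/-- Second-order midpoint estimates for the projected strain. -/
lemma abs_PiA_second_difference_le {w w1 : ℝ → ℝ}
    (hw : ∀ x ∈ Set.Ici (0 : ℝ), HasDerivAt w (w1 x) x) {b : ℕ → ℝ}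
    (hb : ∀ n : ℕ, ∀ x ∈ Set.Icc (n : ℝ) (n + 1), ∀ y ∈ Set.Icc (n : ℝ) (n + 1),
      |w1 x - w1 y| ≤ b n) (n : ℕ) :
    |PiA w n - 2 * PiA w (n + 1) + PiA w (n + 2)| ≤ 6 * (b n + b (n + 1) + b (n + 2)) ∧
    |PiA w (n + 1) - w ((n + 1 : ℕ) + 1 / 2)| ≤ 3 / 2 * (b n + b (n + 1) + b (n + 2)) := by
  set β := b n + b (n + 1) + b (n + 2) with hβ
  set c : ℝ := (n + 1 : ℕ) + 1 / 2 with hc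
  have hc' : c = n + 3 / 2 := by rw [hc]; push_cast; ring
  have hn : (0 : ℝ) ≤ n := n.cast_nonneg
  have hb0 : ∀ n, 0 ≤ b n := fun n => by
    simpa using hb n n ⟨le_rfl, by linarith⟩ n ⟨le_rfl, by linarith⟩
  have hβ0 : 0 ≤ β := by have := hb0 n; have := hb0 (n + 1); have := hb0 (n + 2); positivity
  have hwc : ContinuousOn w (Set.Ici 0) := fun x hx => (hw x hx).continuousAt.continuousWithinAt
  have hosc : ∀ x ∈ Set.Icc (n : ℝ) (n + 3), |w1 x - w1 c| ≤ β := by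
    intro x hx
    have hb1 := hb (n + 1)
    have hb2 := hb (n + 2)
    have := hb0 n
    have := hb0 (n + 1)
    have := hb0 (n + 2)
    push_cast at hb1 hb2
    rcases le_total x (n + 1) with h1 | h1
    · have e1 := hb n x ⟨hx.1, h1⟩ (n + 1) ⟨by linarith, le_rfl⟩
      have e2 := hb1 (n + 1) ⟨le_rfl, by linarith⟩ c ⟨by linarith, by linarith⟩
      rw [abs_le] at *
      constructor <;> linarith [e1.1, e1.2, e2.1, e2.2]
    · rcases le_total x (n + 1 + 1) with h2 | h2
      · refine (hb1 x ⟨h1, h2⟩ c ⟨by linarith, by linarith⟩).trans ?_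
        linarith
      · have e1 := hb2 x ⟨by linarith, by linarith [hx.2]⟩ (n + 2) ⟨le_rfl, by linarith⟩
        have e2 := hb1 (n + 2) ⟨by linarith, by linarith⟩ c ⟨by linarith, by linarith⟩
        rw [abs_le] at *
        constructor <;> linarith [e1.1, e1.2, e2.1, e2.2]
  have haff : ∀ x ∈ Set.Icc (n : ℝ) (n + 3), |w x - (w c + w1 c * (x - c))| ≤ 3 / 2 * β := by
    intro x hx
    refine (abs_sub_affine_le (convex_Icc _ _) (fun y hy => hw y (hn.trans hy.1)) hosc
      ⟨by linarith, by linarith⟩ hx).trans ?_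
    rw [mul_comm]
    refine mul_le_mul_of_nonneg_right ?_ hβ0
    rw [abs_le]
    constructor <;> linarith [hx.1, hx.2]
  have p0 := abs_PiA_sub_affine_le hwc (n := n) fun x hx =>
    haff x ⟨hx.1, by linarith [hx.2]⟩
  have p1 := abs_PiA_sub_affine_le hwc (n := n + 1) fun x hx => by
    push_cast at hx
    exact haff x ⟨by linarith [hx.1], by linarith [hx.2]⟩
  have p2 := abs_PiA_sub_affine_le hwc (n := n + 2) fun x hx => by
    push_cast at hx
    exact haff x ⟨by linarith [hx.1], by linarith [hx.2]⟩
  rw [show ((n : ℝ) + 1 / 2 - c) = -1 by rw [hc']; ring] at p0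
  rw [← hc, sub_self, mul_zero, add_zero] at p1
  rw [show (((n + 2 : ℕ) : ℝ) + 1 / 2 - c) = 1 by rw [hc']; push_cast; ring] at p2
  refine ⟨?_, p1⟩
  rw [abs_le] at *
  constructor <;> linarith [p0.1, p0.2, p1.1, p1.2, p2.1, p2.2]

/-- Dual estimate for a residual split into its boundary and bulk parts. -/
lemma abs_residual_pairing_le {g r v : ℕ → ℝ} {r0 M R R0 : ℝ} (hg : L2Bound g M)
    (hr : L2Bound (fun n => r n - g (n + 1)) R) (hr0 : |r0 - g 0| ≤ R0) (hv : L2Bound v 1) :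
    |(v 0 * r0 + ∑' n, v (n + 1) * r n) - ∑' n, g n * v n| ≤ R0 + R := by
  have hs1 := (hv.shift 1).summable_mul hr
  have hs2 := (hg.shift 1).summable_mul (hv.shift 1)
  have hsplit : ∑' n, v (n + 1) * r n
      = ∑' n, v (n + 1) * (r n - g (n + 1)) + ∑' n, g (n + 1) * v (n + 1) := by
    rw [← hs1.tsum_add hs2]
    exact tsum_congr fun n => by ring
  have hv0 : |v 0 * (r0 - g 0)| ≤ R0 := by
    rw [abs_mul]
    exact (mul_le_of_le_one_left (abs_nonneg _) (hv.abs_le 0)).trans hr0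
  have hbulk := (hv.shift 1).abs_tsum_mul_le hr
  rw [one_mul] at hbulk
  rw [(hg.summable_mul hv).tsum_eq_zero_add, hsplit]
  refine le_trans (le_of_eq ?_) ((abs_add_le _ _).trans (add_le_add hv0 hbulk))
  congr 1
  ring

/-- Replacing the homogeneous strain by the projected strain in the corrector stress balance. -/
lemma SiteBounds.mixed_stress_le {V : ℝ → ℝ → ℝ} {Vs : ℝ → ℝ} {K : ℝ} (hK : SiteBounds V Vs K)
    {F ρ S : ℝ} {p q : ℕ → ℝ} {n : ℕ} (hS : 0 ≤ S) (hρ : 0 ≤ ρ)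
    (hp : ∀ n, |p n - F| ≤ ((n : ℝ) + 1) ^ 2 * S) (hq : ∀ k, n ≤ k → |q k| ≤ ρ)
    (hcrit : d2V V (F + q n) (F + q (n + 1)) + d1V V (F + q (n + 1)) (F + q (n + 2))
      - dW V F = 0) :
    |d2V V (p n + q n) (p (n + 1) + q (n + 1))
        + d1V V (p (n + 1) + q (n + 1)) (p (n + 2) + q (n + 2))
      - (d2V V (p n) (p (n + 1)) + d1V V (p (n + 1)) (p (n + 2)))|
      ≤ 8 * K * S * (ρ * ((n : ℝ) + 3) ^ 2) := by
  have hn : (0 : ℝ) ≤ n := n.cast_nonneg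
  have hp' : ∀ k, k ≤ n + 2 → |p k - F| ≤ ((n : ℝ) + 3) ^ 2 * S := fun k hk => by
    refine (hp k).trans (mul_le_mul_of_nonneg_right (pow_le_pow_left₀ (by positivity) ?_ 2) hS)
    have : (k : ℝ) ≤ n + 2 := by exact_mod_cast hk
    linarith
  have hpair : ∀ i j k l, n ≤ i → n ≤ j → k ≤ n + 2 → l ≤ n + 2 →
      K * ((|q i| + |q j|) * (|p k - F| + |p l - F|)) ≤ 4 * K * S * (ρ * ((n : ℝ) + 3) ^ 2) := by
    intro i j k l hi hj hk hl
    have h1 : |q i| + |q j| ≤ 2 * ρ := by linarith [hq i hi, hq j hj]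
    have h2 : |p k - F| + |p l - F| ≤ 2 * (((n : ℝ) + 3) ^ 2 * S) := by
      linarith [hp' k hk, hp' l hl]
    calc K * ((|q i| + |q j|) * (|p k - F| + |p l - F|))
        ≤ K * ((2 * ρ) * (2 * (((n : ℝ) + 3) ^ 2 * S))) :=
          mul_le_mul_of_nonneg_left (mul_le_mul h1 h2 (by positivity) (by positivity)) hK.nonneg
      _ = _ := by ring
  have h2 := (hK.d2V_mixed (p n) (p (n + 1)) F (q n) (q (n + 1))).trans
    (hpair n (n + 1) n (n + 1) le_rfl (by omega) (by omega) (by omega))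
  have h1 := (hK.d1V_mixed (p (n + 1)) (p (n + 2)) F (q (n + 1)) (q (n + 2))).trans
    (hpair (n + 1) (n + 2) (n + 1) (n + 2) (by omega) (by omega) (by omega) le_rfl)
  have hW := hK.dW_eq F
  rw [abs_le] at *
  constructor <;> linarith [h1.1, h1.2, h2.1, h2.2]

/-- Lipschitz dependence of the bulk stress on the corrector. -/
lemma SiteBounds.bulk_stress_sub_le {V : ℝ → ℝ → ℝ} {Vs : ℝ → ℝ} {K : ℝ} (hK : SiteBounds V Vs K)
    (p q q' : ℕ → ℝ) (n : ℕ) :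
    |d2V V (p n + q' n) (p (n + 1) + q' (n + 1))
        + d1V V (p (n + 1) + q' (n + 1)) (p (n + 2) + q' (n + 2))
      - (d2V V (p n + q n) (p (n + 1) + q (n + 1))
        + d1V V (p (n + 1) + q (n + 1)) (p (n + 2) + q (n + 2)))|
      ≤ K * (|q n - q' n| + 2 * |q (n + 1) - q' (n + 1)| + |q (n + 2) - q' (n + 2)|) := by
  have hsub : ∀ k, |p k + q' k - (p k + q k)| = |q k - q' k| := fun k => by
    rw [← abs_neg]
    congr 1
    ring
  have h2 := hK.d2V_lip (p n + q' n) (p (n + 1) + q' (n + 1)) (p n + q n) (p (n + 1) + q (n + 1))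
  have h1 := hK.d1V_lip (p (n + 1) + q' (n + 1)) (p (n + 2) + q' (n + 2))
    (p (n + 1) + q (n + 1)) (p (n + 2) + q (n + 2))
  simp only [hsub] at h1 h2
  rw [abs_le] at *
  constructor <;> linarith [h1.1, h1.2, h2.1, h2.2]

/-- Consistency of the Cauchy–Born stress in the bulk. -/
lemma SiteBounds.cauchyBorn_stress_le {V : ℝ → ℝ → ℝ} {Vs : ℝ → ℝ} {K : ℝ}
    (hK : SiteBounds V Vs K) {w w1 : ℝ → ℝ}
    (hw : ∀ x ∈ Set.Ici (0 : ℝ), HasDerivAt w (w1 x) x) {a b : ℕ → ℝ}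
    (ha : ∀ n : ℕ, ∀ x ∈ Set.Icc (n : ℝ) (n + 1), ∀ y ∈ Set.Icc (n : ℝ) (n + 1),
      |w x - w y| ≤ a n)
    (hb : ∀ n : ℕ, ∀ x ∈ Set.Icc (n : ℝ) (n + 1), ∀ y ∈ Set.Icc (n : ℝ) (n + 1),
      |w1 x - w1 y| ≤ b n) (n : ℕ) :
    |d2V V (PiA w n) (PiA w (n + 1)) + d1V V (PiA w (n + 1)) (PiA w (n + 2))
      - dW V (w ((n + 1 : ℕ) + 1 / 2))|
      ≤ K * (2 * (a n ^ 2 + 2 * a (n + 1) ^ 2 + a (n + 2) ^ 2)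
        + 15 / 2 * (b n + b (n + 1) + b (n + 2))) := by
  have hwc : ContinuousOn w (Set.Ici 0) := fun x hx => (hw x hx).continuousAt.continuousWithinAt
  obtain ⟨h2nd, hmid⟩ := abs_PiA_second_difference_le hw hb n
  have e1 : |PiA w n - PiA w (n + 1)| ^ 2 ≤ 2 * (a n ^ 2 + a (n + 1) ^ 2) := by
    rw [abs_sub_comm]
    exact (pow_le_pow_left₀ (abs_nonneg _) (abs_PiA_succ_sub_le hwc ha n) 2).trans add_sq_le
  have e2 : |PiA w (n + 2) - PiA w (n + 1)| ^ 2 ≤ 2 * (a (n + 1) ^ 2 + a (n + 2) ^ 2) :=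
    (pow_le_pow_left₀ (abs_nonneg _) (abs_PiA_succ_sub_le hwc ha (n + 1)) 2).trans add_sq_le
  have hs := hK.stress (PiA w n) (PiA w (n + 1)) (PiA w (n + 2))
  have hl := hK.dW_lip (PiA w (n + 1)) (w ((n + 1 : ℕ) + 1 / 2))
  refine (abs_sub_le _ (dW V (PiA w (n + 1))) _).trans ((add_le_add hs hl).trans ?_)
  rw [← mul_add]
  exact mul_le_mul_of_nonneg_left (by linarith) hK.nonneg

/-- Boundary residual of the predictor-corrector approximation. -/
lemma SiteBounds.boundary_residual_le {V : ℝ → ℝ → ℝ} {Vs : ℝ → ℝ} (h : SiteAssumptions V Vs)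
    {K : ℝ} (hK : SiteBounds V Vs K) {f : ℕ → ℝ} (hf : memUstar f) {Cw : ℝ} {w w1 w2 : ℝ → ℝ}
    (hcb : CBSolution V f Cw w w1 w2) {p q q' : ℕ → ℝ} {S ρ : ℝ}
    (hp : ∀ n, |p n - w 0| ≤ ((n : ℝ) + 1) ^ 2 * S) (hρ : ∀ n, |q n - q' n| ≤ ρ)
    (hcrit : deriv Vs (w 0 + q 0) + d1V V (w 0 + q 0) (w 0 + q 1) - dW V (w 0) = 0) :
    |deriv Vs (p 0 + q' 0) + d1V V (p 0 + q' 0) (p 1 + q' 1) - gOf f 0|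
      ≤ K * (6 * S + 3 * ρ) + K * |w1 0| / 2 := by
  obtain ⟨-, hg, hw1⟩ := hcb.pointwise h hf
  obtain ⟨-, -, -, hg0, -⟩ := hf.primitive
  have hf0 : |f 0| ≤ K * |w1 0| := by
    have h1 := hw1 0 le_rfl
    have h2 : fAff f 0 = f 0 := by simp [fAff]
    rw [h2] at h1
    rw [← abs_neg, ← h1, abs_mul, mul_comm]
    exact mul_le_mul_of_nonneg_right (abs_deriv_le_of_abs_sub_le hK.nonneg hK.dW_lip _)
      (abs_nonneg _)
  have hdW : dW V (w 0) - gOf f 0 = f 0 / 2 := by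
    rw [hg 0 le_rfl, hg0]
    ring
  have hshift : ∀ k, |p k + q' k - (w 0 + q k)| ≤ |p k - w 0| + |q k - q' k| := fun k => by
    rw [show p k + q' k - (w 0 + q k) = p k - w 0 - (q k - q' k) by ring]
    exact abs_sub _ _
  have hp0 := hp 0
  have hp1 := hp 1
  norm_num at hp0 hp1
  have e0 : |p 0 + q' 0 - (w 0 + q 0)| ≤ S + ρ := by linarith [hshift 0, hρ 0]
  have e1 : |p 1 + q' 1 - (w 0 + q 1)| ≤ 4 * S + ρ := by linarith [hshift 1, hρ 1]
  have l0 := (hK.dVs_lip (p 0 + q' 0) (w 0 + q 0)).trans (mul_le_mul_of_nonneg_left e0 hK.nonneg)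
  have l1 := (hK.d1V_lip (p 0 + q' 0) (p 1 + q' 1) (w 0 + q 0) (w 0 + q 1)).trans
    (mul_le_mul_of_nonneg_left (add_le_add e0 e1) hK.nonneg)
  rw [abs_le] at *
  constructor <;> linarith [l0.1, l0.2, l1.1, l1.2, hf0.1, hf0.2]

/-- Bulk residual of the predictor-corrector approximation. -/
lemma SiteBounds.exists_l2Bound_bulk_residual {V : ℝ → ℝ → ℝ} {Vs : ℝ → ℝ}
    (h : SiteAssumptions V Vs) {K : ℝ} (hK : SiteBounds V Vs K) {f : ℕ → ℝ} (hf : memUstar f)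
    {Cw : ℝ} {w w1 w2 : ℝ → ℝ} (hcb : CBSolution V f Cw w w1 w2) {a b : ℕ → ℝ}
    (ha : ∀ n : ℕ, ∀ x ∈ Set.Icc (n : ℝ) (n + 1), ∀ y ∈ Set.Icc (n : ℝ) (n + 1),
      |w x - w y| ≤ a n)
    (hb : ∀ n : ℕ, ∀ x ∈ Set.Icc (n : ℝ) (n + 1), ∀ y ∈ Set.Icc (n : ℝ) (n + 1),
      |w1 x - w1 y| ≤ b n)
    {q q' : ℕ → ℝ} {μ c A B D E G S : ℝ} (hμ0 : 0 ≤ μ) (hμ1 : μ ≤ 1) (hc : 0 ≤ c) (hS : 0 ≤ S)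
    (hA : L2Bound (fun n => a n ^ 2) A) (hB : L2Bound b B)
    (hD : L2Bound (fun n => q n - q' n) D) (hE : L2Bound (fun n => f (n + 1) - f n) E)
    (hG : L2Bound (fun n => μ ^ n * ((n : ℝ) + 3) ^ 2) G)
    (hp : ∀ n, |PiA w n - w 0| ≤ ((n : ℝ) + 1) ^ 2 * S) (hq : ∀ n, |q n| ≤ c * μ ^ n)
    (hcrit : ∀ n, d2V V (w 0 + q n) (w 0 + q (n + 1)) + d1V V (w 0 + q (n + 1)) (w 0 + q (n + 2))
      - dW V (w 0) = 0) :
    L2Bound (fun n => d2V V (PiA w n + q' n) (PiA w (n + 1) + q' (n + 1))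
        + d1V V (PiA w (n + 1) + q' (n + 1)) (PiA w (n + 2) + q' (n + 2)) - gOf f (n + 1))
      (K * (4 * D) + 8 * K * S * c * G + K * (8 * A + 45 / 2 * B) + E / 8) := by
  obtain ⟨-, hg, -⟩ := hcb.pointwise h hf
  obtain ⟨-, -, -, -, hgmid⟩ := hf.primitive
  have hK0 := hK.nonneg
  have hT := (((((hD.abs.add ((hD.shift 1).abs.const_mul zero_le_two)).add
    (hD.shift 2).abs).const_mul hK0).add
    (hG.const_mul (mul_nonneg (mul_nonneg (mul_nonneg (by norm_num : (0 : ℝ) ≤ 8) hK0) hS) hc))).add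
    (((((hA.add ((hA.shift 1).const_mul zero_le_two)).add (hA.shift 2)).const_mul
      zero_le_two).add (((hB.add (hB.shift 1)).add (hB.shift 2)).const_mul
      (by norm_num : (0 : ℝ) ≤ 15 / 2))).const_mul hK0)).add
    ((hE.shift 1).abs.const_mul (by norm_num : (0 : ℝ) ≤ 1 / 8))
  refine (hT.of_le (le_of_eq (by ring))).mono' fun n => ?_
  have r1 := hK.bulk_stress_sub_le (PiA w) q q' n
  have hdecay : ∀ k, n ≤ k → |q k| ≤ c * μ ^ n := fun k hk =>
    (hq k).trans (mul_le_mul_of_nonneg_left (pow_le_pow_of_le_one hμ0 hμ1 hk) hc)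
  have r2 := hK.mixed_stress_le hS (mul_nonneg hc (pow_nonneg hμ0 n)) hp hdecay (hcrit n)
  have r3 := hK.cauchyBorn_stress_le hcb.2.2.2.1 ha hb n
  have r4 : |dW V (w ((n + 1 : ℕ) + 1 / 2)) - gOf f (n + 1)|
      = 1 / 8 * |f (n + 1 + 1) - f (n + 1)| := by
    rw [hg _ (by positivity), hgmid (n + 1), sub_sub_cancel_left, abs_neg, abs_div]
    norm_num
    ring
  refine (abs_sub_le _ _ _).trans (add_le_add ((abs_sub_le _ _ _).trans
    (add_le_add ((abs_sub_le _ _ _).trans (add_le_add r1 (r2.trans_eq (by ring)))) r3)) r4.le)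

/-- consistency of the predictor-corrector method: the residual
`‖δ𝓔ᵃ(Π_a u^cb + q_L) − f‖_{𝒰*}` (expressed by testing with all `v ∈ 𝒰` of
unit strain norm) is controlled by the boundary-layer, Cauchy–Born and force
contributions. -/
theorem pc_consistency (V : ℝ → ℝ → ℝ) (Vs : ℝ → ℝ)
    (h : SiteAssumptions V Vs) (ugr : ℕ → ℝ) (ca : ℝ)
    (hgs : StronglyStableGS V Vs ugr ca)
    (μq Cq Cw : ℝ) (hμ0 : 0 ≤ μq) (hμ1 : μq < 1) (hCq : 0 < Cq) (hCw : 0 < Cw) :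
    ∃ ε C : ℝ, ∃ L0 : ℕ, 0 < ε ∧ 0 < C ∧
      ∀ f : ℕ → ℝ, memUstar f → dualNorm f < ε →
      ∀ w w1 w2 : ℝ → ℝ, CBSolution V f Cw w w1 w2 →
      ∀ L : ℕ, L0 ≤ L →
      ∀ qinf qL : ℕ → ℝ,
        memU qinf → CriticalG V Vs (w 0) qinf →
        (∀ ℓ : ℕ, |du qinf ℓ| ≤ Cq * μq ^ ℓ) →
        memQL L qL → (∀ v : ℕ → ℝ, memQL L v → fvG V Vs (w 0) qL v = 0) →
        l2 (fun ℓ => du qinf ℓ - du qL ℓ) ≤ Cq * μq ^ L →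
        ∀ v : ℕ → ℝ, memU v → l2 (du v) = 1 →
          |fvA V Vs (fun ℓ => PiA w ℓ + du qL ℓ) v - pairF f v| ≤
            C * (μq ^ L + |w1 0|
              + Real.sqrt (∫ x in Set.Ioi (0 : ℝ), (w1 x) ^ 4)
              + Real.sqrt (∫ x in Set.Ioi (0 : ℝ), (w2 x) ^ 2)
              + Real.sqrt (∫ x in Set.Ioi (0 : ℝ), (deriv (fAff f) x) ^ 2)) := by
  obtain ⟨K, hK⟩ := h.exists_siteBounds
  obtain ⟨G, hG⟩ := exists_l2Bound_poly_geometric hμ0 hμ1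
  have hK0 := hK.nonneg
  have hG0 := hG.1
  refine ⟨1, 7 * K * Cq + 30 * K + 8 * K * Cq * G + 1, 0, one_pos, by positivity, ?_⟩
  intro f hf _ w w1 w2 hcb L _ qinf qL hqinf hcrit hdecay hqL _ hdist v hv hv1
  obtain ⟨a, haL, ha⟩ := hcb.exists_oscillation_bound_strain h hf
  obtain ⟨b, hbL, hb⟩ := hcb.exists_oscillation_bound_gradient h hK hf
  obtain ⟨⟨M, hM⟩, hfs, -, -, -⟩ := hf.primitive
  have hE := l2Bound_sub_fAff hfs
  set A := Real.sqrt (∫ x in Set.Ioi (0 : ℝ), w1 x ^ 4)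
  set B := Real.sqrt (∫ x in Set.Ioi (0 : ℝ), w2 x ^ 2)
  set E := Real.sqrt (∫ x in Set.Ioi (0 : ℝ), deriv (fAff f) x ^ 2)
  have hd : L2Bound (fun n => du qinf n - du qL n) (Cq * μq ^ L) :=
    (L2Bound.of_summable (((L2Bound.of_summable hqinf.2).abs.add
      (L2Bound.of_summable hqL.1.2).abs).mono' fun n => abs_sub _ _).summable).of_le hdist
  have hvL : L2Bound (du v) 1 := hv1 ▸ L2Bound.of_summable hv.2
  have hp := abs_PiA_sub_boundary_le hcb.2.2.2.1 hbL hb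
  have hS : 0 ≤ |w1 0| + B := add_nonneg (abs_nonneg _) hbL.1
  have hbulk := hK.exists_l2Bound_bulk_residual h hf hcb ha hb hμ0 hμ1.le hCq.le hS haL hbL hd hE
    hG hp hdecay hcrit.2
  have hbdry := hK.boundary_residual_le h hf hcb hp hd.abs_le hcrit.1
  refine (abs_residual_pairing_le hM hbulk hbdry hvL).trans ?_
  have hX := abs_nonneg (w1 0)
  have hA0 := haL.1
  have hB0 := hbL.1
  have hE0 := hE.1
  have hL0 := pow_nonneg hμ0 L
  have hKC : 0 ≤ K * Cq := by positivity
  have hKCG : 0 ≤ K * Cq * G := by positivity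
  set C := 7 * K * Cq + 30 * K + 8 * K * Cq * G + 1 with hC
  have t1 : 7 * K * Cq * μq ^ L ≤ C * μq ^ L := mul_le_mul_of_nonneg_right (by linarith) hL0
  have t2 : (13 / 2 * K + 8 * K * Cq * G) * |w1 0| ≤ C * |w1 0| :=
    mul_le_mul_of_nonneg_right (by linarith) hX
  have t3 : 8 * K * A ≤ C * A := mul_le_mul_of_nonneg_right (by linarith) hA0
  have t4 : (57 / 2 * K + 8 * K * Cq * G) * B ≤ C * B :=
    mul_le_mul_of_nonneg_right (by linarith) hB0
  have t5 : 1 / 8 * E ≤ C * E := mul_le_mul_of_nonneg_right (by linarith) hE0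
  linarith
end
end

section
/- Let ℋ be a real Hilbert space and 𝒢 ∈ C¹(ℋ, ℋ*) with Lipschitz-continuous derivative: ‖δ𝒢(u) − δ𝒢(v)‖_{ℒ(ℋ,ℋ*)} ≤ M‖u − v‖_ℋ for all u, v ∈ ℋ. Suppose ū ∈ ℋ satisfies ‖𝒢(ū)‖_{ℋ*} ≤ η and ⟨δ𝒢(ū)v, v⟩ ≥ γ‖v‖²_ℋ for all v ∈ ℋ, where M, η, γ > 0 satisfy 2Mη/γ² < 1. Then there exists a locally unique u ∈ ℋ with 𝒢(u) = 0, ‖u − ū‖_ℋ ≤ 2η/γ, and ⟨δ𝒢(u)v, v⟩ ≥ (1 − 2Mη/γ²)γ‖v‖²_ℋ for all v ∈ ℋ. -/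
open scoped BigOperators ENNReal
open Filter MeasureTheory

noncomputable section

/-- The second-order Taylor bound for a map with Lipschitz derivative. -/
theorem norm_sub_sub_fderiv_le {E F : Type*} [NormedAddCommGroup E] [NormedSpace ℝ E]
    [NormedAddCommGroup F] [NormedSpace ℝ F] {G : E → F} {M : ℝ} (hG : Differentiable ℝ G)
    (hLip : ∀ u v : E, ‖fderiv ℝ G u - fderiv ℝ G v‖ ≤ M * ‖u - v‖) (a x : E) :
    ‖G x - G a - fderiv ℝ G a (x - a)‖ ≤ M / 2 * ‖x - a‖ ^ 2 := by
  set h := x - a with hh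
  have hderiv (t : ℝ) : HasDerivAt (fun t : ℝ ↦ G (a + t • h) - G a - t • fderiv ℝ G a h)
      (fderiv ℝ G (a + t • h) h - fderiv ℝ G a h) t := by
    have hline : HasDerivAt (fun t : ℝ ↦ a + t • h) h t := by
      simpa using ((hasDerivAt_id t).smul_const h).const_add a
    have hcomp := (hG (a + t • h)).hasFDerivAt.comp_hasDerivAt t hline
    simpa [Pi.sub_def] using
      (hcomp.sub_const (G a)).sub ((hasDerivAt_id t).smul_const (fderiv ℝ G a h))
  have hbound := image_norm_le_of_norm_deriv_right_le_deriv_boundary (a := 0) (b := 1)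
    (B := fun t : ℝ ↦ M / 2 * ‖h‖ ^ 2 * t ^ 2) (B' := fun t : ℝ ↦ M * ‖h‖ ^ 2 * t)
    (fun t _ ↦ (hderiv t).continuousAt.continuousWithinAt)
    (fun t _ ↦ (hderiv t).hasDerivWithinAt) (by simp)
    (fun t ↦ by
      convert! (hasDerivAt_pow 2 t).const_mul (M / 2 * ‖h‖ ^ 2) using 1
      simp
      ring)
    (fun t ht ↦ by
      calc ‖fderiv ℝ G (a + t • h) h - fderiv ℝ G a h‖
          ≤ ‖fderiv ℝ G (a + t • h) - fderiv ℝ G a‖ * ‖h‖ := by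
            rw [← sub_apply]
            exact ContinuousLinearMap.le_opNorm _ _
        _ ≤ M * ‖a + t • h - a‖ * ‖h‖ := by gcongr; exact hLip _ _
        _ = M * ‖h‖ ^ 2 * t := by
            rw [add_sub_cancel_left, norm_smul, Real.norm_of_nonneg ht.1]
            ring)
    (Set.right_mem_Icc.2 zero_le_one)
  simpa [hh] using hbound

/-- A map whose derivative is `M`-Lipschitz is approximated by its linearization at the center of
a ball of radius `r` up to the Lipschitz constant `M * r`. -/
theorem norm_sub_sub_fderiv_le_of_mem_closedBall {E F : Type*} [NormedAddCommGroup E]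
    [NormedSpace ℝ E] [NormedAddCommGroup F] [NormedSpace ℝ F] {G : E → F} {M r : ℝ} (hM : 0 ≤ M)
    (hG : Differentiable ℝ G)
    (hLip : ∀ u v : E, ‖fderiv ℝ G u - fderiv ℝ G v‖ ≤ M * ‖u - v‖) {a x y : E}
    (hx : x ∈ Metric.closedBall a r) (hy : y ∈ Metric.closedBall a r) :
    ‖G y - G x - fderiv ℝ G a (y - x)‖ ≤ M * r * ‖y - x‖ :=
  (convex_closedBall a r).norm_image_sub_le_of_norm_fderiv_le' (fun z _ ↦ hG z)
    (fun z hz ↦ (hLip z a).trans (by gcongr; exact mem_closedBall_iff_norm.1 hz)) hx hy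

section Coercive

variable {H : Type*} [NormedAddCommGroup H] [InnerProductSpace ℝ H]

/-- A coercive operator into the dual is bounded below. -/
theorem mul_norm_le_norm_of_coercive {A : H →L[ℝ] H →L[ℝ] ℝ} {γ : ℝ}
    (hA : ∀ v : H, γ * ‖v‖ ^ 2 ≤ A v v) (w : H) : γ * ‖w‖ ≤ ‖A w‖ := by
  rcases eq_or_ne w 0 with rfl | hw
  · simp
  refine le_of_mul_le_mul_right ?_ (norm_pos_iff.2 hw)
  calc γ * ‖w‖ * ‖w‖ = γ * ‖w‖ ^ 2 := by ring
    _ ≤ A w w := hA w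
    _ ≤ ‖A w w‖ := Real.le_norm_self _
    _ ≤ ‖A w‖ * ‖w‖ := (A w).le_opNorm w

/-- A coercive operator into the dual is surjective (Lax–Milgram). -/
theorem surjective_of_coercive [CompleteSpace H] {A : H →L[ℝ] H →L[ℝ] ℝ} {γ : ℝ} (hγ : 0 < γ)
    (hA : ∀ v : H, γ * ‖v‖ ^ 2 ≤ A v v) : Function.Surjective A := by
  have hcoercive : IsCoercive A := ⟨γ, hγ, fun v ↦ by simpa [pow_two, mul_assoc] using hA v⟩
  intro f
  refine ⟨hcoercive.continuousLinearEquivOfBilin.symm ((InnerProductSpace.toDual ℝ H).symm f), ?_⟩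
  ext w
  rw [← hcoercive.continuousLinearEquivOfBilin_apply]
  simp

/-- Coercivity persists under perturbations, with the constant reduced by their norm. -/
theorem coercive_of_norm_sub_le {A B : H →L[ℝ] H →L[ℝ] ℝ} {γ δ : ℝ}
    (hA : ∀ v : H, γ * ‖v‖ ^ 2 ≤ A v v) (hAB : ‖B - A‖ ≤ δ) (v : H) :
    (γ - δ) * ‖v‖ ^ 2 ≤ B v v := by
  have hdiff : ‖(B - A) v v‖ ≤ δ * ‖v‖ * ‖v‖ :=
    ((B - A).le_opNorm₂ v v).trans (by gcongr)
  have hlower := neg_le_of_abs_le hdiff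
  simp only [sub_apply] at hlower
  linarith [hA v, show δ * ‖v‖ * ‖v‖ = δ * ‖v‖ ^ 2 by ring]

end Coercive

/-- quantitative inverse function theorem on a Hilbert space. -/
theorem quantitative_inverse_function_theorem
    {H : Type*} [NormedAddCommGroup H] [InnerProductSpace ℝ H] [CompleteSpace H]
    (G : H → (H →L[ℝ] ℝ)) (M η γ : ℝ)
    (hM : 0 < M) (hη : 0 < η) (hγ : 0 < γ)
    (hC1 : ContDiff ℝ 1 G)
    (hLip : ∀ u v : H, ‖fderiv ℝ G u - fderiv ℝ G v‖ ≤ M * ‖u - v‖)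
    (ubar : H) (hres : ‖G ubar‖ ≤ η)
    (hstab : ∀ v : H, γ * ‖v‖ ^ 2 ≤ fderiv ℝ G ubar v v)
    (hrel : 2 * M * η / γ ^ 2 < 1) :
    ∃ u : H, G u = 0 ∧ ‖u - ubar‖ ≤ 2 * η / γ ∧
      (∀ v : H, (1 - 2 * M * η / γ ^ 2) * γ * ‖v‖ ^ 2 ≤ fderiv ℝ G u v v) ∧
      ∀ u' : H, ‖u' - ubar‖ ≤ 2 * η / γ → G u' = 0 → u' = u := by
  have hG : Differentiable ℝ G := hC1.differentiable one_ne_zero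
  set A := fderiv ℝ G ubar with hA
  set r := 2 * η / γ with hr
  set κ := 2 * M * η / γ ^ 2 with hκ
  have hr0 : 0 ≤ r := by positivity
  have hκ0 : 0 ≤ κ := by positivity
  have hMr : M * r = κ * γ := by rw [hr, hκ]; field_simp
  have hγr : γ * r = 2 * η := by rw [hr]; field_simp
  choose S hS using surjective_of_coercive hγ hstab
  set T : H → H := fun x ↦ x - S (G x) with hT
  have hmaps : Set.MapsTo T (Metric.closedBall ubar r) (Metric.closedBall ubar r) := by
    intro x hx
    rw [mem_closedBall_iff_norm] at hx ⊢
    refine le_of_mul_le_mul_left ((mul_norm_le_norm_of_coercive hstab _).trans ?_) hγ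
    have hlin : A (T x - ubar) = -(G x - G ubar - A (x - ubar)) - G ubar := by
      simp only [hT, map_sub, hS]
      abel
    calc ‖A (T x - ubar)‖ ≤ M / 2 * ‖x - ubar‖ ^ 2 + η := by
          rw [hlin]
          refine (norm_sub_le _ _).trans (add_le_add ?_ hres)
          rw [norm_neg]
          exact norm_sub_sub_fderiv_le hG hLip ubar x
      _ ≤ M / 2 * r ^ 2 + η := by gcongr
      _ = κ * η + η := by
          linear_combination r / 2 * hMr + κ / 2 * hγr
      _ ≤ γ * r := by nlinarith
  have hcontr : ∀ x ∈ Metric.closedBall ubar r, ∀ y ∈ Metric.closedBall ubar r,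
      ‖T x - T y‖ ≤ κ * ‖x - y‖ := by
    intro x hx y hy
    refine le_of_mul_le_mul_left ((mul_norm_le_norm_of_coercive hstab _).trans ?_) hγ
    have hlin : A (T x - T y) = -(G x - G y - A (x - y)) := by
      simp only [hT, map_sub, hS]
      abel
    rw [hlin, norm_neg, ← mul_assoc, mul_comm γ, ← hMr]
    exact norm_sub_sub_fderiv_le_of_mem_closedBall hM.le hG hLip hy hx
  have hcontracting : ContractingWith ⟨κ, hκ0⟩ (hmaps.restrict T _ _) :=
    ⟨by exact_mod_cast hrel, LipschitzWith.of_dist_le_mul fun x y ↦ by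
      rw [Subtype.dist_eq, Subtype.dist_eq, dist_eq_norm, dist_eq_norm]
      exact hcontr x x.2 y y.2⟩
  obtain ⟨u, hu, hfix, -⟩ := ContractingWith.exists_fixedPoint'
    Metric.isClosed_closedBall.isComplete hmaps hcontracting
    (Metric.mem_closedBall_self hr0) (edist_ne_top _ _)
  have hSu : S (G u) = 0 := sub_eq_self.1 hfix
  have hzero : G u = 0 := by rw [← hS (G u), hSu, map_zero]
  have hnorm : ‖u - ubar‖ ≤ r := mem_closedBall_iff_norm.1 hu
  refine ⟨u, hzero, hnorm, fun v ↦ ?_, fun u' hu' hzero' ↦ ?_⟩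
  · have hder : ‖fderiv ℝ G u - A‖ ≤ κ * γ :=
      (hLip u ubar).trans (hMr ▸ by gcongr)
    simpa [sub_mul] using coercive_of_norm_sub_le hstab hder v
  · have hle := hcontr u' (mem_closedBall_iff_norm.2 hu') u hu
    simp only [hT, hzero, hzero', sub_sub_sub_cancel_right] at hle
    have hnonpos : ‖u' - u‖ ≤ 0 := by nlinarith [norm_nonneg (u' - u)]
    exact sub_eq_zero.1 (norm_le_zero_iff.1 hnonpos)
end
end
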